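/- arXiv:2009.12160 — 4 statements merged into one kernel-verified Lean document; each statement's English description precedes it below -/
import Mathlib

section
/- Higher-order Herglotz variational principle (in coordinates, Q = ℝⁿ): Let L be a Lagrangian of order k, let z₀ ∈ ℝ, and let c : [0,1] → ℝⁿ be smooth. For any smooth curve b : [0,1] → ℝⁿ let Z_b : [0,1] → ℝ be the (assumed to exist and be unique) solution of Z_b′(t) = L(b̄ᵏ(t), Z_b(t)) with Z_b(0) = z₀, and set 𝒜(b) = Z_b(1). Then c is a critical point of 𝒜 — meaning: for every δ > 0 and every smooth family C : (−δ,δ) × [0,1] → ℝⁿ with C(0,·) = c, such that (λ,t) ↦ Z_{C(λ,·)}(t) is smooth and such that for each 0 ≤ j < k the variations ∂_λ ∂_t^j C(0,t) vanish at t = 0 and t = 1, one has d/dλ 𝒜(C(λ,·))|_{λ=0} = 0 — if and only if for all t ∈ [0,1] and all i = 1,…,n, Σ_{α=0}^{k} (−1)^α 𝒟^α( t ↦ (∂L/∂q_α^i)(c̄ᵏ(t), Z_c(t)) )(t) = 0, where 𝒟 is the operator sending a function f : [0,1] → ℝ to 𝒟f(t) = f′(t) − (∂L/∂z)(c̄ᵏ(t),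 Z_c(t)) f(t). -/
open scoped BigOperators

noncomputable section

namespace HOC

/-- Infinite-jet coordinates `(q_α)_{α ∈ ℕ}` with each `q_α ∈ ℝⁿ`. -/
abbrev Jet (n : ℕ) := ℕ → Fin n → ℝ

/-- Partial derivative of a jet function with respect to the coordinate `q_α^i`. -/
def pq {n : ℕ} (F : Jet n → ℝ → ℝ) (α : ℕ) (i : Fin n) (q : Jet n) (z : ℝ) : ℝ :=
  deriv (fun s : ℝ => F (Function.update q α (Function.update (q α) i s)) z) (q α i)

/-- Partial derivative of a jet function with respect to `z`. -/
def pz {n : ℕ} (F : Jet n → ℝ → ℝ) (q : Jet n) (z : ℝ) : ℝ :=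
  deriv (fun w => F q w) z

/-- Extension of a function of `(q₀,…,q_k,z)` to the jet space, ignoring higher coordinates. -/
def ext {n : ℕ} (k : ℕ) (L : (Fin (k+1) → Fin n → ℝ) → ℝ → ℝ) : Jet n → ℝ → ℝ :=
  fun q z => L (fun α => q α.val) z

/-- The Lagrangian total derivative `D_L` acting on functions of `(q₀,…,q_r,z)`. -/
def DL {n : ℕ} (Lx : Jet n → ℝ → ℝ) (r : ℕ) (F : Jet n → ℝ → ℝ) : Jet n → ℝ → ℝ :=
  fun q z =>
    (∑ α ∈ Finset.range (r+1), ∑ i : Fin n, q (α+1) i * pq F α i q z)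
      + Lx q z * pz F q z - pz Lx q z * F q z

/-- Iterated Lagrangian total derivative `D_L^α`, applied to a function of order `r`. -/
def DLpow {n : ℕ} (Lx : Jet n → ℝ → ℝ) (r : ℕ) : ℕ → (Jet n → ℝ → ℝ) → (Jet n → ℝ → ℝ)
  | 0, F => F
  | (α+1), F => DL Lx (r + α) (DLpow Lx r α F)

/-- The infinite jet lift of a curve `c : ℝ → ℝⁿ`. -/
def lift {n : ℕ} (c : ℝ → Fin n → ℝ) (t : ℝ) : Jet n :=
  fun α => iteratedDeriv α c t

/-- The `k`-jet lift `c̄ᵏ(t) = (c(t), c'(t), …, c⁽ᵏ⁾(t))`. -/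
def jetk {n : ℕ} (k : ℕ) (c : ℝ → Fin n → ℝ) (t : ℝ) : Fin (k+1) → Fin n → ℝ :=
  fun α => iteratedDeriv α.val c t

/-- Smoothness of a Lagrangian of order `k`. -/
def SmoothL {n k : ℕ} (L : (Fin (k+1) → Fin n → ℝ) → ℝ → ℝ) : Prop :=
  ContDiff ℝ (⊤ : ℕ∞) (fun p : (Fin (k+1) → Fin n → ℝ) × ℝ => L p.1 p.2)

/-- The Jacobi–Ostrogradskii momentum `p̂^{r-1}_i = ∑_{α=0}^{k-r} (-1)^α D_L^α (∂L/∂q_{r+α}^i)`. -/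
def momentum {n : ℕ} (k : ℕ) (L : (Fin (k+1) → Fin n → ℝ) → ℝ → ℝ) (r : ℕ) (i : Fin n) :
    Jet n → ℝ → ℝ :=
  fun q z => ∑ α ∈ Finset.range (k - r + 1),
    (-1:ℝ)^α * DLpow (ext k L) k α (pq (ext k L) (r + α) i) q z

/-- The `2k`-th order Herglotz (contact Euler–Lagrange) equations for the pair `(c, z)`. -/
def HerglotzEqs {n : ℕ} (k : ℕ) (L : (Fin (k+1) → Fin n → ℝ) → ℝ → ℝ)
    (c : ℝ → Fin n → ℝ) (z : ℝ → ℝ) : Prop :=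
  ∀ (t : ℝ) (i : Fin n),
    ∑ α ∈ Finset.range (k+1),
      (-1:ℝ)^α * DLpow (ext k L) k α (pq (ext k L) α i) (lift c t) (z t) = 0

/-- The Herglotz ODE `z'(t) = L(c̄ᵏ(t), z(t))`. -/
def HerglotzODE {n : ℕ} (k : ℕ) (L : (Fin (k+1) → Fin n → ℝ) → ℝ → ℝ)
    (c : ℝ → Fin n → ℝ) (z : ℝ → ℝ) : Prop :=
  ∀ t : ℝ, HasDerivAt z (L (jetk k c t) (z t)) t

/-- The Lagrangian energy `E_L = ∑_{r=1}^{k} ∑_i p̂^{r-1}_i q_r^i - L`. -/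
def energy {n : ℕ} (k : ℕ) (L : (Fin (k+1) → Fin n → ℝ) → ℝ → ℝ) : Jet n → ℝ → ℝ :=
  fun q z =>
    (∑ r ∈ Finset.range k, ∑ i : Fin n, momentum k L (r+1) i q z * q (r+1) i) - ext k L q z

/-- Padding a finite collection of coordinates by zero to an infinite jet. -/
def padJet {n : ℕ} (m : ℕ) (q : Fin m → Fin n → ℝ) : Jet n :=
  fun α => if h : α < m then q ⟨α, h⟩ else 0

/-- The generalized Legendre map in coordinates:
`Leg (q₀,…,q_{2k-1}, z) = (q₀,…,q_{k-1}, p̂⁰,…,p̂^{k-1}, z)`. -/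
def Leg {n : ℕ} (k : ℕ) (L : (Fin (k+1) → Fin n → ℝ) → ℝ → ℝ) :
    ((Fin (2*k) → Fin n → ℝ) × ℝ) → ((Fin (2*k) → Fin n → ℝ) × ℝ) :=
  fun w =>
    (fun β i => if (β : ℕ) < k then w.1 β i
      else momentum k L ((β : ℕ) - k + 1) i (padJet (2*k) w.1) w.2, w.2)

open Set Filter Topology MeasureTheory
open scoped ContDiff

/-- A function of two real variables whose partial derivatives are `C^n` is `C^(n+1)`. -/
lemma contDiff_succ_of_hasDerivAt_partial {n : ℕ} {F F₁ F₂ : ℝ × ℝ → ℝ}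
    (h₁ : ∀ x t, HasDerivAt (fun y => F (y, t)) (F₁ (x, t)) x)
    (h₂ : ∀ x t, HasDerivAt (fun s => F (x, s)) (F₂ (x, t)) t)
    (c₁ : ContDiff ℝ n F₁) (c₂ : ContDiff ℝ n F₂) : ContDiff ℝ (n + 1) F := by
  rw [contDiff_succ_iff_hasFDerivAt]
  let f₁ : ℝ → ℝ → ℝ →L[ℝ] ℝ := fun x t => ContinuousLinearMap.toSpanSingleton ℝ (F₁ (x, t))
  let f₂ : ℝ → ℝ → ℝ →L[ℝ] ℝ := fun x t => ContinuousLinearMap.toSpanSingleton ℝ (F₂ (x, t))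
  have e : ∀ G : ℝ × ℝ → ℝ, ∀ m : ℕ, ContDiff ℝ m G →
      ContDiff ℝ m fun p => ContinuousLinearMap.toSpanSingleton ℝ (G p) := fun G m hG =>
    (ContinuousLinearMap.toSpanSingletonCLE (𝕜 := ℝ) (E := ℝ)).contDiff.comp hG
  refine ⟨fun p => F₁ p • ContinuousLinearMap.fst ℝ ℝ ℝ + F₂ p • ContinuousLinearMap.snd ℝ ℝ ℝ,
    (c₁.smul contDiff_const).add (c₂.smul contDiff_const), fun p => ?_⟩
  have := (hasStrictFDerivAt_uncurry_coprod (𝕜 := ℝ) (u := p) (f := fun x t => F (x, t))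
    (f₁ := f₁) (f₂ := f₂)
    (Eventually.of_forall fun v => (h₁ v.1 v.2).hasFDerivAt)
    (Eventually.of_forall fun v => (h₂ v.1 v.2).hasFDerivAt)
    (e F₁ n c₁).continuous.continuousAt
    (e F₂ n c₂).continuous.continuousAt).hasFDerivAt
  refine this.congr_fderiv ?_
  ext <;> simp [f₁, f₂, Function.HasUncurry.uncurry]

/-- The endpoint of the solution of a scalar ODE on `[0, 1]` depends continuously on parameters. -/
lemma continuous_ode_endpoint {P : Type*} [TopologicalSpace P] {f f' : P → ℝ → ℝ → ℝ}
    (hf : Continuous fun q : P × ℝ × ℝ => f q.1 q.2.1 q.2.2)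
    (hf' : Continuous fun q : P × ℝ × ℝ => f' q.1 q.2.1 q.2.2)
    (hd : ∀ p t x, HasDerivAt (f p t) (f' p t x) x) {y : P → ℝ → ℝ} {y₀ : ℝ}
    (h0 : ∀ p, y p 0 = y₀) (hy : ∀ p t, HasDerivAt (y p) (f p t (y p t)) t) :
    Continuous fun p => y p 1 := by
  have hyc : ∀ p, Continuous (y p) := fun p =>
    continuous_iff_continuousAt.2 fun t => (hy p t).continuousAt
  rw [continuous_iff_continuousAt]
  intro p₀
  have hK : IsCompact (Icc (0:ℝ) 1 ×ˢ Icc (-1:ℝ) 1) := isCompact_Icc.prod isCompact_Icc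
  have hg' : Continuous fun q : P × ℝ × ℝ => |f' q.1 q.2.1 (y p₀ q.2.1 + q.2.2)| := by
    have := hyc p₀
    exact (hf'.comp (by fun_prop : Continuous fun q : P × ℝ × ℝ =>
      (q.1, q.2.1, y p₀ q.2.1 + q.2.2))).abs
  obtain ⟨M, hM⟩ : ∃ M, ∀ q ∈ Icc (0:ℝ) 1 ×ˢ Icc (-1:ℝ) 1,
      |f' p₀ q.1 (y p₀ q.1 + q.2)| < M := by
    obtain ⟨M, hM⟩ := (hK.image (hg'.comp (by fun_prop : Continuous fun q : ℝ × ℝ =>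
      (p₀, q)))).bddAbove
    exact ⟨M + 1, fun q hq => lt_of_le_of_lt (hM (mem_image_of_mem _ hq)) (lt_add_one M)⟩
  have hM0 : 0 ≤ M := (abs_nonneg _).trans (hM (0, 0) (by simp)).le
  have ev1 : ∀ᶠ p in 𝓝 p₀, ∀ q ∈ Icc (0:ℝ) 1 ×ˢ Icc (-1:ℝ) 1,
      |f' p q.1 (y p₀ q.1 + q.2)| < M :=
    hK.eventually_forall_of_forall_eventually fun q hq =>
      hg'.continuousAt.eventually_lt continuousAt_const (hM q hq)
  rw [ContinuousAt, Metric.tendsto_nhds]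
  intro ε hε
  obtain ⟨δ, hδ, hδ0⟩ : ∃ δ, gronwallBound 0 M δ 1 < min ε 1 ∧ 0 < δ := by
    have h1 : ∀ᶠ δ in 𝓝[>] (0:ℝ), gronwallBound 0 M δ 1 < min ε 1 := by
      refine ((gronwallBound_continuous_ε 0 M 1).continuousAt.eventually_lt
        continuousAt_const ?_).filter_mono nhdsWithin_le_nhds
      simp [gronwallBound_ε0_δ0, hε]
    exact (h1.and self_mem_nhdsWithin).exists
  have ev2 : ∀ᶠ p in 𝓝 p₀, ∀ s ∈ Icc (0:ℝ) 1, |f p s (y p₀ s) - f p₀ s (y p₀ s)| < δ := by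
    refine isCompact_Icc.eventually_forall_of_forall_eventually fun s _ => ?_
    have hc : Continuous fun q : P × ℝ => |f q.1 q.2 (y p₀ q.2) - f p₀ q.2 (y p₀ q.2)| := by
      have := hyc p₀
      exact ((hf.comp (by fun_prop : Continuous fun q : P × ℝ => (q.1, q.2, y p₀ q.2))).sub
        (hf.comp (by fun_prop : Continuous fun q : P × ℝ => (p₀, q.2, y p₀ q.2)))).abs
    exact hc.continuousAt.eventually_lt continuousAt_const (by simpa using hδ0)
  filter_upwards [ev1, ev2] with p hp1 hp2
  have hwd : ∀ s, HasDerivAt (fun s => y p s - y p₀ s)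
      (f p s (y p s) - f p₀ s (y p₀ s)) s := fun s => (hy p s).sub (hy p₀ s)
  have hwc : Continuous fun s => y p s - y p₀ s := (hyc p).sub (hyc p₀)
  have key : ∀ τ ∈ Icc (0:ℝ) 1, (∀ s ∈ Ico 0 τ, |y p s - y p₀ s| ≤ 1) →
      |y p τ - y p₀ τ| < min ε 1 := by
    intro τ hτ hs
    have h := norm_le_gronwallBound_of_norm_deriv_right_le (δ := 0) (K := M) (ε := δ)
      (a := 0) (b := τ) hwc.continuousOn (fun s _ => (hwd s).hasDerivWithinAt)
      (by simp [h0]) (fun s hs' => ?_) τ ⟨hτ.1, le_rfl⟩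
    · refine lt_of_le_of_lt (h.trans ?_) hδ
      exact gronwallBound_mono le_rfl hδ0.le hM0 (by linarith [hτ.2])
    · have hs01 : s ∈ Icc (0:ℝ) 1 := ⟨hs'.1, (hs'.2.trans_le hτ.2).le⟩
      have hw := abs_le.1 (hs s hs')
      have h1 : ‖f p s (y p s) - f p s (y p₀ s)‖ ≤ M * ‖y p s - y p₀ s‖ := by
        refine (convex_Icc (y p₀ s - 1) (y p₀ s + 1)).norm_image_sub_le_of_norm_hasDerivWithin_le
          (f' := f' p s) (fun x _ => (hd p s x).hasDerivWithinAt) (fun x hx => ?_)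
          ⟨by linarith, by linarith⟩ ⟨by linarith [hw.1], by linarith [hw.2]⟩
        have := hp1 (s, x - y p₀ s) ⟨hs01, by constructor <;> linarith [hx.1, hx.2]⟩
        simpa using this.le
      have h2 := hp2 s hs01
      rw [← Real.norm_eq_abs] at h2
      calc ‖f p s (y p s) - f p₀ s (y p₀ s)‖
          = ‖(f p s (y p s) - f p s (y p₀ s)) + (f p s (y p₀ s) - f p₀ s (y p₀ s))‖ := by
            congr 1; ring
        _ ≤ _ := (norm_add_le _ _).trans (add_le_add h1 h2.le)
  have hall : ∀ s ∈ Icc (0:ℝ) 1, |y p s - y p₀ s| < 1 := by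
    by_contra! hcon
    have hcl : IsCompact (Icc (0:ℝ) 1 ∩ {s | 1 ≤ |y p s - y p₀ s|}) :=
      isCompact_Icc.inter_right (isClosed_le continuous_const hwc.abs)
    obtain ⟨s₀, hs₀, hs₀'⟩ := hcon
    obtain ⟨τ, ⟨hτ, hτ1⟩, hmin⟩ := hcl.exists_isLeast ⟨s₀, hs₀, hs₀'⟩
    have := key τ hτ fun s hs => by
      by_contra! h
      exact absurd (hmin ⟨⟨hs.1, (hs.2.trans_le hτ.2).le⟩, h.le⟩) (not_le.2 hs.2)
    exact absurd (this.trans_le (min_le_right _ _)) (not_lt.2 hτ1)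
  exact (key 1 (by simp) fun s hs => (hall s ⟨hs.1, hs.2.le⟩).le).trans_le (min_le_left _ _)

/-- The solution of the scalar linear equation `u' = A + B u`, `u 0 = 0`. -/
def linearSolution (A B : ℝ → ℝ) (t : ℝ) : ℝ :=
  Real.exp (∫ s in 0..t, B s) * ∫ s in 0..t, Real.exp (-∫ r in 0..s, B r) * A s

/-- Variation of constants for the scalar linear equation `u' = A + B u`, `u 0 = 0`. -/
lemma eq_linearSolution {A B u : ℝ → ℝ} (hA : Continuous A) (hB : Continuous B)
    (hu0 : u 0 = 0) (hu : ∀ t, HasDerivAt u (A t + B t * u t) t) (t : ℝ) :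
    u t = linearSolution A B t := by
  have hβ : ∀ t, HasDerivAt (fun t => ∫ s in 0..t, B s) (B t) t := fun t =>
    intervalIntegral.integral_hasDerivAt_right (hB.intervalIntegrable _ _)
      (hB.stronglyMeasurableAtFilter _ _) hB.continuousAt
  have hβc : Continuous fun t => ∫ s in 0..t, B s :=
    continuous_iff_continuousAt.2 fun t => (hβ t).continuousAt
  have h : ∀ t, HasDerivAt (fun t => Real.exp (-∫ s in 0..t, B s) * u t)
      (Real.exp (-∫ s in 0..t, B s) * A t) t := fun t => by
    refine ((hβ t).fun_neg.exp.mul (hu t)).congr_deriv ?_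
    ring
  rw [linearSolution, intervalIntegral.integral_eq_sub_of_hasDerivAt (fun s _ => h s)
    ((hβc.neg.rexp.mul hA).intervalIntegrable _ _), hu0, mul_zero, sub_zero, ← mul_assoc,
    ← Real.exp_add, add_neg_cancel, Real.exp_zero, one_mul]

/-- Hadamard's lemma: the increment of a `C^1` function is a linear form in the increment of the
argument, depending continuously on both endpoints. -/
lemma exists_hadamard {E : Type*} [NormedAddCommGroup E] [NormedSpace ℝ E] {f : E → ℝ}
    (hf : ContDiff ℝ 1 f) :
    ∃ G : E → E → E →L[ℝ] ℝ, (Continuous fun p : E × E => G p.1 p.2) ∧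
      (∀ x y, f y - f x = G x y (y - x)) ∧ ∀ x, G x x = fderiv ℝ f x := by
  have hc : Continuous (fderiv ℝ f) := hf.continuous_fderiv one_ne_zero
  refine ⟨fun x y => ∫ θ in (0:ℝ)..1, fderiv ℝ f (x + θ • (y - x)), ?_, fun x y => ?_, fun x => ?_⟩
  · exact intervalIntegral.continuous_parametric_intervalIntegral_of_continuous'
      (f := fun (p : E × E) θ => fderiv ℝ f (p.1 + θ • (p.2 - p.1)))
      (hc.comp (by fun_prop :
        Continuous fun q : (E × E) × ℝ => q.1.1 + q.2 • (q.1.2 - q.1.1))) 0 1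
  · have hcx : Continuous fun θ : ℝ => fderiv ℝ f (x + θ • (y - x)) := hc.comp (by fun_prop)
    have hd : ∀ θ : ℝ, HasDerivAt (fun θ : ℝ => f (x + θ • (y - x)))
        (fderiv ℝ f (x + θ • (y - x)) (y - x)) θ := fun θ => by
      have h1 : HasDerivAt (fun θ : ℝ => x + θ • (y - x)) (y - x) θ := by
        simpa using ((hasDerivAt_id θ).smul_const (y - x)).const_add x
      exact ((hf.differentiable one_ne_zero _).hasFDerivAt).comp_hasDerivAt θ h1
    rw [ContinuousLinearMap.intervalIntegral_apply (hcx.intervalIntegrable _ _),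
      intervalIntegral.integral_eq_sub_of_hasDerivAt (fun θ _ => hd θ)
        ((hcx.clm_apply continuous_const).intervalIntegrable _ _)]
    simp
  · simp

/-- The primitive in `t` of a `C^n` function of `(x, t)` is `C^n` in `(x, t)`. -/
lemma contDiff_parametric_primitive {n : ℕ} {g : ℝ → ℝ → ℝ}
    (hg : ContDiff ℝ n fun p : ℝ × ℝ => g p.1 p.2) :
    ContDiff ℝ n fun p : ℝ × ℝ => ∫ s in 0..p.2, g p.1 s := by
  induction n generalizing g with
  | zero =>
    rw [Nat.cast_zero, contDiff_zero] at hg ⊢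
    exact intervalIntegral.continuous_parametric_intervalIntegral_of_continuous
      (f := fun p : ℝ × ℝ => g p.1)
      (hg.comp (by fun_prop : Continuous fun q : (ℝ × ℝ) × ℝ => (q.1.1, q.2))) continuous_snd
  | succ n ih =>
    have hgd : Differentiable ℝ fun p : ℝ × ℝ => g p.1 p.2 := hg.differentiable (by simp)
    let g' : ℝ → ℝ → ℝ := fun x t => fderiv ℝ (fun p : ℝ × ℝ => g p.1 p.2) (x, t) (1, 0)
    have hg' : ContDiff ℝ n fun p : ℝ × ℝ => g' p.1 p.2 :=
      (hg.fderiv_right (by push_cast; rfl)).clm_apply contDiff_const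
    have hdx : ∀ x t, HasDerivAt (fun y => g y t) (g' x t) x := fun x t =>
      (hgd (x, t)).hasFDerivAt.comp_hasDerivAt (f := fun y => (y, t)) x
        ((hasDerivAt_id x).prodMk (hasDerivAt_const x t))
    have hgx : ∀ x, Continuous (g x) := fun x =>
      hg.continuous.comp (by fun_prop : Continuous fun s : ℝ => (x, s))
    have hgx' : ∀ x, Continuous (g' x) := fun x =>
      hg'.continuous.comp (by fun_prop : Continuous fun s : ℝ => (x, s))
    push_cast
    refine contDiff_succ_of_hasDerivAt_partial (F₁ := fun p => ∫ s in 0..p.2, g' p.1 s)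
      (F₂ := fun p => g p.1 p.2) (fun x t => ?_) (fun x t => ?_) (ih hg')
      (hg.of_le (by norm_cast; simp))
    · obtain ⟨M, hM⟩ := ((isCompact_Icc (a := x - 1) (b := x + 1)).prod
        (isCompact_uIcc (a := (0:ℝ)) (b := t))).exists_bound_of_continuousOn
          hg'.continuous.continuousOn
      refine (intervalIntegral.hasDerivAt_integral_of_dominated_loc_of_deriv_le
        (bound := fun _ => M) (Icc_mem_nhds (by linarith) (by linarith : x < x + 1))
        (Eventually.of_forall fun y => (hgx y).aestronglyMeasurable)
        ((hgx x).intervalIntegrable _ _) (hgx' x).aestronglyMeasurable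
        (Eventually.of_forall fun s hs y hy => hM (y, s) ⟨hy, uIoc_subset_uIcc hs⟩)
        intervalIntegrable_const (Eventually.of_forall fun s _ y _ => hdx y s)).2
    · exact intervalIntegral.integral_hasDerivAt_right ((hgx x).intervalIntegrable _ _)
        ((hgx x).stronglyMeasurableAtFilter _ _) (hgx x).continuousAt

lemma contDiff_linearSolution {n : ℕ} {A B : ℝ → ℝ → ℝ}
    (hA : ContDiff ℝ n fun p : ℝ × ℝ => A p.1 p.2) (hB : ContDiff ℝ n fun p : ℝ × ℝ => B p.1 p.2) :
    ContDiff ℝ n fun p : ℝ × ℝ => linearSolution (A p.1) (B p.1) p.2 :=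
  (contDiff_parametric_primitive hB).exp.mul
    (contDiff_parametric_primitive (g := fun x s => Real.exp (-∫ r in 0..s, B x r) * A x s)
      ((contDiff_parametric_primitive hB).neg.exp.mul hA))

lemma continuous_ode_solution {f : ℝ → ℝ → ℝ → ℝ} {z : ℝ → ℝ → ℝ} {z₀ : ℝ}
    (hf : ContDiff ℝ 1 fun q : ℝ × ℝ × ℝ => f q.1 q.2.1 q.2.2) (h0 : ∀ x, z x 0 = z₀)
    (hz : ∀ x t, HasDerivAt (z x) (f x t (z x t)) t) :
    Continuous fun p : ℝ × ℝ => z p.1 p.2 := by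
  have hfd : Continuous (fderiv ℝ fun q : ℝ × ℝ × ℝ => f q.1 q.2.1 q.2.2) :=
    hf.continuous_fderiv one_ne_zero
  have hfc := hf.continuous
  have h := continuous_ode_endpoint (P := ℝ × ℝ) (f := fun p s v => f p.1 (p.2 * s) v * p.2)
    (f' := fun p s v => fderiv ℝ (fun q : ℝ × ℝ × ℝ => f q.1 q.2.1 q.2.2)
      (p.1, p.2 * s, v) (0, 0, 1) * p.2) (y := fun p s => z p.1 (p.2 * s)) (y₀ := z₀)
    ((hfc.comp (by fun_prop : Continuous fun q : (ℝ × ℝ) × ℝ × ℝ =>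
      (q.1.1, q.1.2 * q.2.1, q.2.2))).mul (by fun_prop))
    (((hfd.comp (by fun_prop : Continuous fun q : (ℝ × ℝ) × ℝ × ℝ =>
      (q.1.1, q.1.2 * q.2.1, q.2.2))).clm_apply continuous_const).mul (by fun_prop))
    (fun p s v => ?_) (fun p => by simp [h0]) (fun p s => ?_)
  · simpa using h
  · exact ((hf.differentiable one_ne_zero (p.1, p.2 * s, v)).hasFDerivAt.comp_hasDerivAt
      (f := fun v => (p.1, p.2 * s, v)) v ((hasDerivAt_const v p.1).prodMk
        ((hasDerivAt_const v (p.2 * s)).prodMk (hasDerivAt_id v)))).mul_const p.2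
  · exact (hz p.1 (p.2 * s)).comp s (by simpa using (hasDerivAt_id s).const_mul p.2)

/-- The solution of a scalar ODE is differentiable in the parameter, and its derivative solves the
linearized equation. -/
lemma hasDerivAt_ode_solution_param {f : ℝ → ℝ → ℝ → ℝ} {z : ℝ → ℝ → ℝ} {z₀ : ℝ}
    (hf : ContDiff ℝ 1 fun q : ℝ × ℝ × ℝ => f q.1 q.2.1 q.2.2) (h0 : ∀ x, z x 0 = z₀)
    (hz : ∀ x t, HasDerivAt (z x) (f x t (z x t)) t) (x t : ℝ) :
    HasDerivAt (fun y => z y t) (linearSolution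
      (fun s => fderiv ℝ (fun q : ℝ × ℝ × ℝ => f q.1 q.2.1 q.2.2) (x, s, z x s) (1, 0, 0))
      (fun s => fderiv ℝ (fun q : ℝ × ℝ × ℝ => f q.1 q.2.1 q.2.2) (x, s, z x s) (0, 0, 1)) t)
      x := by
  have hzc := continuous_ode_solution hf h0 hz
  obtain ⟨G, hGc, hG, hGd⟩ := exists_hadamard hf
  have hcurve : Continuous fun p : ℝ × ℝ => ((x, p.2, z x p.2), (p.1, p.2, z p.1 p.2)) := by
    have : Continuous fun p : ℝ × ℝ => z x p.2 :=
      hzc.comp (by fun_prop : Continuous fun p : ℝ × ℝ => (x, p.2))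
    fun_prop
  let A : ℝ → ℝ → ℝ := fun y s => G (x, s, z x s) (y, s, z y s) (1, 0, 0)
  let B : ℝ → ℝ → ℝ := fun y s => G (x, s, z x s) (y, s, z y s) (0, 0, 1)
  have hA : Continuous fun p : ℝ × ℝ => A p.1 p.2 := (hGc.comp hcurve).clm_apply continuous_const
  have hB : Continuous fun p : ℝ × ℝ => B p.1 p.2 := (hGc.comp hcurve).clm_apply continuous_const
  have hQ : Continuous fun p : ℝ × ℝ => linearSolution (A p.1) (B p.1) p.2 :=
    (contDiff_linearSolution (n := 0) (by exact_mod_cast contDiff_zero.2 hA)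
      (by exact_mod_cast contDiff_zero.2 hB)).continuous
  have hinc : ∀ y, z y t - z x t = (y - x) * linearSolution (A y) (B y) t := fun y => by
    have hAy : Continuous (A y) := hA.comp (by fun_prop : Continuous fun s : ℝ => (y, s))
    have hBy : Continuous (B y) := hB.comp (by fun_prop : Continuous fun s : ℝ => (y, s))
    rw [eq_linearSolution (A := fun s => (y - x) * A y s) (B := B y)
      (u := fun s => z y s - z x s) (continuous_const.mul hAy) hBy (by simp [h0]) (fun s => ?_) t]
    · simp only [linearSolution, mul_left_comm _ (y - x), intervalIntegral.integral_const_mul]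
    · refine ((hz y s).sub (hz x s)).congr_deriv ?_
      have e : ((y, s, z y s) - (x, s, z x s) : ℝ × ℝ × ℝ) =
          (y - x) • ((1, 0, 0) : ℝ × ℝ × ℝ) + (z y s - z x s) • ((0, 0, 1) : ℝ × ℝ × ℝ) := by
        simp
      have := hG (x, s, z x s) (y, s, z y s)
      rw [e, map_add, map_smul, map_smul] at this
      simpa [A, B, mul_comm] using this
  have hlim : Tendsto (fun y => linearSolution (A y) (B y) t) (𝓝[≠] x)
      (𝓝 (linearSolution (A x) (B x) t)) :=
    ((hQ.comp (by fun_prop : Continuous fun y : ℝ => (y, t))).tendsto x).mono_left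
      nhdsWithin_le_nhds
  simp only [A, B, hGd] at hlim
  rw [hasDerivAt_iff_tendsto_slope]
  refine hlim.congr' ?_
  filter_upwards [self_mem_nhdsWithin] with y hy
  rw [slope_def_field, hinc, mul_div_cancel_left₀ _ (sub_ne_zero.2 hy)]

/-- The solution of a scalar ODE depends smoothly on time and on a parameter. -/
lemma contDiff_ode_solution {f : ℝ → ℝ → ℝ → ℝ} {z : ℝ → ℝ → ℝ} {z₀ : ℝ}
    (hf : ContDiff ℝ ∞ fun q : ℝ × ℝ × ℝ => f q.1 q.2.1 q.2.2) (h0 : ∀ x, z x 0 = z₀)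
    (hz : ∀ x t, HasDerivAt (z x) (f x t (z x t)) t) :
    ContDiff ℝ ∞ fun p : ℝ × ℝ => z p.1 p.2 := by
  have hf1 : ContDiff ℝ 1 fun q : ℝ × ℝ × ℝ => f q.1 q.2.1 q.2.2 := hf.of_le (by norm_cast)
  rw [contDiff_infty]
  intro n
  induction n with
  | zero => exact_mod_cast contDiff_zero.2 (continuous_ode_solution hf1 h0 hz)
  | succ n ih =>
    have hgraph : ContDiff ℝ n fun p : ℝ × ℝ => (p.1, p.2, z p.1 p.2) := by fun_prop
    have hfd : ContDiff ℝ n (fderiv ℝ fun q : ℝ × ℝ × ℝ => f q.1 q.2.1 q.2.2) :=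
      hf.fderiv_right (by norm_cast; simp)
    push_cast
    exact contDiff_succ_of_hasDerivAt_partial
      (fun x t => hasDerivAt_ode_solution_param hf1 h0 hz x t) (fun x t => hz x t)
      (contDiff_linearSolution
        (A := fun x s => fderiv ℝ (fun q : ℝ × ℝ × ℝ => f q.1 q.2.1 q.2.2) (x, s, z x s) (1, 0, 0))
        (B := fun x s => fderiv ℝ (fun q : ℝ × ℝ × ℝ => f q.1 q.2.1 q.2.2) (x, s, z x s) (0, 0, 1))
        ((hfd.comp hgraph).clm_apply contDiff_const)
        ((hfd.comp hgraph).clm_apply contDiff_const))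
      ((contDiff_infty.1 hf n).comp hgraph)

section MixedPartials

variable {E : Type*} [NormedAddCommGroup E] [NormedSpace ℝ E] {g : ℝ → ℝ → E}

lemma hasDerivAt_fst_of_contDiff (hg : ContDiff ℝ ∞ fun p : ℝ × ℝ => g p.1 p.2) (x t : ℝ) :
    HasDerivAt (fun y => g y t) (fderiv ℝ (fun p : ℝ × ℝ => g p.1 p.2) (x, t) (1, 0)) x :=
  (hg.differentiable (by simp) (x, t)).hasFDerivAt.comp_hasDerivAt (f := fun y => (y, t)) x
    ((hasDerivAt_id x).prodMk (hasDerivAt_const x t))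

lemma hasDerivAt_snd_of_contDiff (hg : ContDiff ℝ ∞ fun p : ℝ × ℝ => g p.1 p.2) (x t : ℝ) :
    HasDerivAt (g x) (fderiv ℝ (fun p : ℝ × ℝ => g p.1 p.2) (x, t) (0, 1)) t :=
  (hg.differentiable (by simp) (x, t)).hasFDerivAt.comp_hasDerivAt (f := fun s => (x, s)) t
    ((hasDerivAt_const t x).prodMk (hasDerivAt_id t))

lemma contDiff_deriv_snd (hg : ContDiff ℝ ∞ fun p : ℝ × ℝ => g p.1 p.2) :
    ContDiff ℝ ∞ fun p : ℝ × ℝ => deriv (g p.1) p.2 := by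
  simp only [fun x t => (hasDerivAt_snd_of_contDiff hg x t).deriv]
  exact (hg.fderiv_right (m := ∞) (by simp)).clm_apply contDiff_const

lemma contDiff_deriv_fst (hg : ContDiff ℝ ∞ fun p : ℝ × ℝ => g p.1 p.2) :
    ContDiff ℝ ∞ fun p : ℝ × ℝ => deriv (fun x => g x p.2) p.1 := by
  simp only [fun x t => (hasDerivAt_fst_of_contDiff hg x t).deriv]
  exact (hg.fderiv_right (m := ∞) (by simp)).clm_apply contDiff_const

lemma deriv_deriv_comm (hg : ContDiff ℝ ∞ fun p : ℝ × ℝ => g p.1 p.2) (x t : ℝ) :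
    deriv (fun y => deriv (g y) t) x = deriv (fun s => deriv (fun y => g y s) x) t := by
  have hd : Differentiable ℝ (fderiv ℝ fun p : ℝ × ℝ => g p.1 p.2) :=
    (hg.fderiv_right (m := ∞) (by simp)).differentiable (by simp)
  have h1 := (hasDerivAt_fst_of_contDiff
    (g := fun x t => deriv (g x) t) (contDiff_deriv_snd hg) x t).deriv
  have h2 := (hasDerivAt_snd_of_contDiff
    (g := fun x t => deriv (fun y => g y t) x) (contDiff_deriv_fst hg) x t).deriv
  simp only [fun x t => (hasDerivAt_snd_of_contDiff hg x t).deriv,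
    fun x t => (hasDerivAt_fst_of_contDiff hg x t).deriv] at h1 h2 ⊢
  rw [h1, h2, fderiv_clm_apply (hd _) (differentiableAt_const _),
    fderiv_clm_apply (hd _) (differentiableAt_const _)]
  simpa using (hg.contDiffAt.isSymmSndFDerivAt (by
    simpa using ENat.LEInfty.out (m := 2))) (1, 0) (0, 1)

lemma contDiff_iteratedDeriv_snd (hg : ContDiff ℝ ∞ fun p : ℝ × ℝ => g p.1 p.2) (j : ℕ) :
    ContDiff ℝ ∞ fun p : ℝ × ℝ => iteratedDeriv j (g p.1) p.2 := by
  induction j generalizing g with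
  | zero => simpa using hg
  | succ j ih =>
    simp only [iteratedDeriv_succ']
    exact ih (g := fun x => deriv (g x)) (contDiff_deriv_snd hg)

lemma hasDerivAt_iteratedDeriv_snd (hg : ContDiff ℝ ∞ fun p : ℝ × ℝ => g p.1 p.2) (j : ℕ)
    (x t : ℝ) :
    HasDerivAt (fun y => iteratedDeriv j (g y) t)
      (iteratedDeriv j (fun s => deriv (fun y => g y s) x) t) x := by
  induction j generalizing g with
  | zero =>
    simpa using (hasDerivAt_fst_of_contDiff hg x t).differentiableAt.hasDerivAt
  | succ j ih =>
    simp only [iteratedDeriv_succ']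
    have := ih (g := fun x => deriv (g x)) (contDiff_deriv_snd hg)
    simpa only [deriv_deriv_comm hg] using this

end MixedPartials

lemma iteratedDeriv_pi_apply {ι : Type*} [Fintype ι] {h : ℝ → ι → ℝ} (hh : ContDiff ℝ ∞ h) (j : ℕ)
    (t : ℝ) (i : ι) : iteratedDeriv j h t i = iteratedDeriv j (fun s => h s i) t := by
  induction j generalizing h with
  | zero => simp
  | succ j ih =>
    have hd : ∀ s, deriv (fun r => h r i) s = deriv h s i := fun s => by
      rw [deriv_pi fun i' => (differentiable_pi.1 (hh.differentiable (by simp)) i') s]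
    rw [iteratedDeriv_succ', iteratedDeriv_succ', ih hh.deriv', funext hd]

/-- The operator `f ↦ f' - B f`. -/
def dampedDeriv (B : ℝ → ℝ) (f : ℝ → ℝ) : ℝ → ℝ := fun s => deriv f s - B s * f s

lemma contDiff_iterate_dampedDeriv {B f : ℝ → ℝ} (hB : ContDiff ℝ ∞ B) (hf : ContDiff ℝ ∞ f)
    (m : ℕ) : ContDiff ℝ ∞ ((dampedDeriv B)^[m] f) := by
  induction m generalizing f with
  | zero => exact hf
  | succ m ih => exact ih ((contDiff_infty_iff_deriv.1 hf).2.sub (hB.mul hf))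

/-- With the weight `exp (-∫ B)`, the operator `f ↦ -(f' - B f)` is the formal adjoint of the
derivative. -/
lemma integral_mul_iteratedDeriv {B f h : ℝ → ℝ} (hB : ContDiff ℝ ∞ B) (hf : ContDiff ℝ ∞ f)
    (hh : ContDiff ℝ ∞ h) (m : ℕ) {a b : ℝ}
    (hbd : ∀ j < m, iteratedDeriv j h a = 0 ∧ iteratedDeriv j h b = 0) :
    ∫ s in a..b, Real.exp (-∫ r in 0..s, B r) * (f s * iteratedDeriv m h s) =
      (-1) ^ m * ∫ s in a..b, Real.exp (-∫ r in 0..s, B r) * ((dampedDeriv B)^[m] f s * h s) := by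
  induction m generalizing f with
  | zero => simp
  | succ m ih =>
    have hβ : ∀ t, HasDerivAt (fun t => ∫ s in 0..t, B s) (B t) t := fun t =>
      intervalIntegral.integral_hasDerivAt_right (hB.continuous.intervalIntegrable _ _)
        (hB.continuous.stronglyMeasurableAtFilter _ _) hB.continuous.continuousAt
    have hβc : Continuous fun t => ∫ s in 0..t, B s :=
      continuous_iff_continuousAt.2 fun t => (hβ t).continuousAt
    have hfd := contDiff_infty_iff_deriv.1 hf
    have hDf : ContDiff ℝ ∞ (dampedDeriv B f) := hfd.2.sub (hB.mul hf)
    have hu : ∀ s, HasDerivAt (fun s => Real.exp (-∫ r in 0..s, B r) * f s)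
        (Real.exp (-∫ r in 0..s, B r) * dampedDeriv B f s) s := fun s => by
      refine ((hβ s).fun_neg.exp.mul (hfd.1 s).hasDerivAt).congr_deriv ?_
      rw [dampedDeriv]
      ring
    have hv : ∀ s, HasDerivAt (iteratedDeriv m h) (iteratedDeriv (m + 1) h s) s := fun s => by
      rw [iteratedDeriv_succ]
      exact (hh.differentiable_iteratedDeriv m
        (by exact_mod_cast WithTop.coe_lt_top _) s).hasDerivAt
    have hvc : ∀ j : ℕ, Continuous (iteratedDeriv j h) := fun j =>
      hh.continuous_iteratedDeriv j (by exact_mod_cast le_top)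
    have := intervalIntegral.integral_mul_deriv_eq_deriv_mul (a := a) (b := b)
      (fun s _ => hu s) (fun s _ => hv s)
      ((hβc.neg.rexp.mul hDf.continuous).intervalIntegrable _ _)
      ((hvc (m + 1)).intervalIntegrable _ _)
    simp only [mul_assoc] at this
    rw [this, ih hDf fun j hj => hbd j (hj.trans (Nat.lt_succ_self m)),
      (hbd m (Nat.lt_succ_self m)).1, (hbd m (Nat.lt_succ_self m)).2, Function.iterate_succ_apply]
    ring

section Lagrangian

variable {n k : ℕ} {L : (Fin (k + 1) → Fin n → ℝ) → ℝ → ℝ}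

lemma pz_ext_eq_fderiv (hL : SmoothL L) (q : Jet n) (z : ℝ) :
    pz (ext k L) q z =
      fderiv ℝ (fun p : (Fin (k + 1) → Fin n → ℝ) × ℝ => L p.1 p.2) (fun β => q β, z) (0, 1) :=
  (((hL.differentiable (by simp) (fun β : Fin (k + 1) => q β, z)).hasFDerivAt).comp_hasDerivAt
    (f := fun w => (fun β : Fin (k + 1) => q β, w)) z
    ((hasDerivAt_const z _).prodMk (hasDerivAt_id z))).deriv

lemma pq_ext_eq_fderiv (hL : SmoothL L) (q : Jet n) (z : ℝ) (α : Fin (k + 1)) (i : Fin n) :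
    pq (ext k L) α i q z =
      fderiv ℝ (fun p : (Fin (k + 1) → Fin n → ℝ) × ℝ => L p.1 p.2) (fun β => q β, z)
        (Pi.single α (Pi.single i 1), 0) := by
  let γ : ℝ → Fin (k + 1) → Fin n → ℝ :=
    fun s β => Function.update q α (Function.update (q α) i s) β
  have hγ0 : γ (q α i) = fun β : Fin (k + 1) => q β := by simp [γ]
  have hγ : HasDerivAt γ (Pi.single α (Pi.single i 1)) (q α i) := by
    rw [hasDerivAt_pi]
    intro β
    by_cases hβ : β = α
    · subst hβ
      simpa [γ] using hasDerivAt_update (q β) i (q β i)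
    · have hβ' : (β : ℕ) ≠ α := fun h => hβ (Fin.ext h)
      simpa [γ, hβ, hβ'] using hasDerivAt_const (q α i) (q β)
  have h := (hL.differentiable (by simp) (γ (q α i), z)).hasFDerivAt.comp_hasDerivAt
    (f := fun s => (γ s, z)) (q α i) (hγ.prodMk (hasDerivAt_const _ z))
  rw [hγ0] at h
  exact h.deriv

lemma fderiv_eq_sum_pq (hL : SmoothL L) (q : Jet n) (z : ℝ) (v : Fin (k + 1) → Fin n → ℝ) :
    fderiv ℝ (fun p : (Fin (k + 1) → Fin n → ℝ) × ℝ => L p.1 p.2) (fun β => q β, z) (v, 0) =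
      ∑ α : Fin (k + 1), ∑ i, pq (ext k L) α i q z * v α i := by
  simp only [pq_ext_eq_fderiv hL]
  generalize fderiv ℝ (fun p : (Fin (k + 1) → Fin n → ℝ) × ℝ => L p.1 p.2) (fun β => q β, z) = ℓ
  have hv : v = ∑ α, ∑ i, v α i • (Pi.single α (Pi.single i 1) : Fin (k + 1) → Fin n → ℝ) := by
    ext β j
    simp [Finset.sum_apply, Pi.single_apply, apply_ite, ite_apply]
  have hℓ : ∀ w, ℓ (w, 0) = (ℓ.comp (ContinuousLinearMap.inl ℝ _ ℝ)) w := fun w => rfl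
  simp only [hℓ]
  conv_lhs => rw [hv]
  simp only [map_sum, map_smul, smul_eq_mul, mul_comm]

lemma contDiff_jetk {c : ℝ → Fin n → ℝ} (hc : ContDiff ℝ ∞ c) : ContDiff ℝ ∞ (jetk k c) :=
  contDiff_pi.2 fun α => (contDiff_iteratedDeriv_snd (g := fun _ : ℝ => c)
    (hc.comp contDiff_snd) α).comp (contDiff_prodMk_right (0 : ℝ))

lemma contDiff_jetk_snd {C : ℝ → ℝ → Fin n → ℝ} (hC : ContDiff ℝ ∞ fun p : ℝ × ℝ => C p.1 p.2) :
    ContDiff ℝ ∞ fun p : ℝ × ℝ => jetk k (C p.1) p.2 :=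
  contDiff_pi.2 fun α => contDiff_iteratedDeriv_snd hC α

lemma hasDerivAt_jetk {C : ℝ → ℝ → Fin n → ℝ} (hC : ContDiff ℝ ∞ fun p : ℝ × ℝ => C p.1 p.2)
    (x t : ℝ) :
    HasDerivAt (fun y => jetk k (C y) t) (jetk k (fun s => deriv (fun y => C y s) x) t) x :=
  hasDerivAt_pi.2 fun α => hasDerivAt_iteratedDeriv_snd hC α x t

/-- The Herglotz ODE along a smooth family of curves has a smooth right-hand side. -/
lemma contDiff_lagrangian_family (hL : SmoothL L) {C : ℝ → ℝ → Fin n → ℝ}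
    (hC : ContDiff ℝ ∞ fun p : ℝ × ℝ => C p.1 p.2) :
    ContDiff ℝ ∞ fun q : ℝ × ℝ × ℝ => L (jetk k (C q.1) q.2.1) q.2.2 :=
  hL.comp (((contDiff_jetk_snd hC).comp
    (by fun_prop : ContDiff ℝ ∞ fun q : ℝ × ℝ × ℝ => (q.1, q.2.1))).prodMk (by fun_prop))

/-- The first variation of the Herglotz action. -/
lemma hasDerivAt_action (hL : SmoothL L) {z₀ : ℝ} {Z : ℝ → ℝ → ℝ} {C : ℝ → ℝ → Fin n → ℝ}
    (hC : ContDiff ℝ ∞ fun p : ℝ × ℝ => C p.1 p.2) (h0 : ∀ x, Z x 0 = z₀)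
    (hZ : ∀ x t, HasDerivAt (Z x) (L (jetk k (C x) t) (Z x t)) t) (x t : ℝ) :
    HasDerivAt (fun y => Z y t) (linearSolution
      (fun s => ∑ α : Fin (k + 1), ∑ i, pq (ext k L) α i (lift (C x) s) (Z x s) *
        iteratedDeriv α (fun s => deriv (fun y => C y s) x) s i)
      (fun s => pz (ext k L) (lift (C x) s) (Z x s)) t) x := by
  have hf := contDiff_lagrangian_family hL hC
  have hLd : ∀ p, HasFDerivAt (fun p : (Fin (k + 1) → Fin n → ℝ) × ℝ => L p.1 p.2)
      (fderiv ℝ (fun p : (Fin (k + 1) → Fin n → ℝ) × ℝ => L p.1 p.2) p) p :=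
    fun p => (hL.differentiable (by simp) p).hasFDerivAt
  have hfd : ∀ p, HasFDerivAt (fun q : ℝ × ℝ × ℝ => L (jetk k (C q.1) q.2.1) q.2.2)
      (fderiv ℝ (fun q : ℝ × ℝ × ℝ => L (jetk k (C q.1) q.2.1) q.2.2) p) p :=
    fun p => (hf.differentiable (by simp) p).hasFDerivAt
  convert hasDerivAt_ode_solution_param (f := fun x t v => L (jetk k (C x) t) v)
    (hf.of_le (by norm_cast)) h0 hZ x t using 3 with s s
  · refine (fderiv_eq_sum_pq hL _ _ (jetk k _ s)).symm.trans ?_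
    exact HasDerivAt.unique
      ((hLd (jetk k (C x) s, Z x s)).comp_hasDerivAt (f := fun y => (jetk k (C y) s, Z x s)) x
        ((hasDerivAt_jetk hC x s).prodMk (hasDerivAt_const x _)))
      ((hfd (x, s, Z x s)).comp_hasDerivAt (f := fun y => (y, s, Z x s)) x
        ((hasDerivAt_id x).prodMk (hasDerivAt_const x _)))
  · refine (pz_ext_eq_fderiv hL _ _).trans ?_
    exact HasDerivAt.unique
      ((hLd (jetk k (C x) s, Z x s)).comp_hasDerivAt (f := fun w => (jetk k (C x) s, w)) (Z x s)
        ((hasDerivAt_const _ _).prodMk (hasDerivAt_id _)))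
      ((hfd (x, s, Z x s)).comp_hasDerivAt (f := fun w => (x, s, w)) (Z x s)
        ((hasDerivAt_const _ x).prodMk ((hasDerivAt_const _ s).prodMk (hasDerivAt_id _))))

variable {c : ℝ → Fin n → ℝ} {z : ℝ → ℝ}

lemma contDiff_pz_ext (hL : SmoothL L) (hc : ContDiff ℝ ∞ c) (hz : ContDiff ℝ ∞ z) :
    ContDiff ℝ ∞ fun s => pz (ext k L) (lift c s) (z s) := by
  simp only [pz_ext_eq_fderiv hL]
  exact ((hL.fderiv_right (m := ∞) (by simp)).comp
    ((contDiff_jetk hc).prodMk hz)).clm_apply contDiff_const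

lemma contDiff_pq_ext (hL : SmoothL L) (hc : ContDiff ℝ ∞ c) (hz : ContDiff ℝ ∞ z)
    (α : Fin (k + 1)) (i : Fin n) :
    ContDiff ℝ ∞ fun s => pq (ext k L) α i (lift c s) (z s) := by
  simp only [pq_ext_eq_fderiv hL]
  exact ((hL.fderiv_right (m := ∞) (by simp)).comp
    ((contDiff_jetk hc).prodMk hz)).clm_apply contDiff_const

/-- The left-hand side of the `i`-th Herglotz equation along `(c, z)`. -/
def herglotzExpr (k : ℕ) (L : (Fin (k + 1) → Fin n → ℝ) → ℝ → ℝ) (c : ℝ → Fin n → ℝ)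
    (z : ℝ → ℝ) (i : Fin n) (t : ℝ) : ℝ :=
  ∑ α : Fin (k + 1), (-1) ^ (α : ℕ) *
    (dampedDeriv fun s => pz (ext k L) (lift c s) (z s))^[α]
      (fun s => pq (ext k L) α i (lift c s) (z s)) t

lemma contDiff_herglotzExpr (hL : SmoothL L) (hc : ContDiff ℝ ∞ c) (hz : ContDiff ℝ ∞ z)
    (i : Fin n) : ContDiff ℝ ∞ (herglotzExpr k L c z i) :=
  ContDiff.sum fun α _ => contDiff_const.mul (contDiff_iterate_dampedDeriv
    (contDiff_pz_ext hL hc hz) (contDiff_pq_ext hL hc hz α i) α)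

/-- Integration by parts in the first variation of the Herglotz action. -/
lemma integral_variation_eq (hL : SmoothL L) (hc : ContDiff ℝ ∞ c) (hz : ContDiff ℝ ∞ z)
    {η : ℝ → Fin n → ℝ} (hη : ContDiff ℝ ∞ η) {a b : ℝ}
    (hbd : ∀ j < k, iteratedDeriv j η a = 0 ∧ iteratedDeriv j η b = 0) :
    ∫ s in a..b, Real.exp (-∫ r in 0..s, pz (ext k L) (lift c r) (z r)) *
        ∑ α : Fin (k + 1), ∑ i, pq (ext k L) α i (lift c s) (z s) * iteratedDeriv α η s i =
      ∑ i, ∫ s in a..b, Real.exp (-∫ r in 0..s, pz (ext k L) (lift c r) (z r)) *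
        (herglotzExpr k L c z i s * η s i) := by
  have hB := contDiff_pz_ext hL hc hz
  have hηi : ∀ i, ContDiff ℝ ∞ fun s => η s i := fun i => contDiff_pi.1 hη i
  have hσ : Continuous fun s => Real.exp (-∫ r in 0..s, pz (ext k L) (lift c r) (z r)) :=
    (intervalIntegral.continuous_primitive
      (fun _ _ => hB.continuous.intervalIntegrable _ _) _).neg.rexp
  have hP := fun α i => contDiff_pq_ext (k := k) hL hc hz α i
  have hD : ∀ (α : Fin (k + 1)) i, Continuous fun s => (-1) ^ (α : ℕ) *
      (Real.exp (-∫ r in 0..s, pz (ext k L) (lift c r) (z r)) *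
        ((dampedDeriv fun s => pz (ext k L) (lift c s) (z s))^[α]
          (fun s => pq (ext k L) α i (lift c s) (z s)) s * η s i)) := fun α i =>
    continuous_const.mul (hσ.mul ((contDiff_iterate_dampedDeriv hB (hP α i) α).continuous.mul
      (hηi i).continuous))
  have hI : ∀ (α : Fin (k + 1)) i, Continuous fun s =>
      Real.exp (-∫ r in 0..s, pz (ext k L) (lift c r) (z r)) *
        (pq (ext k L) α i (lift c s) (z s) * iteratedDeriv α (fun s => η s i) s) := fun α i =>
    hσ.mul ((hP α i).continuous.mul
      ((hηi i).continuous_iteratedDeriv α (by exact_mod_cast le_top)))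
  simp only [herglotzExpr, Finset.mul_sum, Finset.sum_mul, iteratedDeriv_pi_apply hη]
  rw [intervalIntegral.integral_finsetSum fun α _ =>
    (continuous_finsetSum _ fun i _ => hI α i).intervalIntegrable _ _]
  simp only [mul_assoc, mul_left_comm _ ((-1 : ℝ) ^ _)]
  rw [Finset.sum_congr rfl fun α _ => intervalIntegral.integral_finsetSum fun i _ =>
      (hI α i).intervalIntegrable _ _, Finset.sum_comm]
  refine Finset.sum_congr rfl fun i _ => ?_
  rw [intervalIntegral.integral_finsetSum fun α _ => (hD α i).intervalIntegrable _ _]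
  refine Finset.sum_congr rfl fun α _ => ?_
  rw [intervalIntegral.integral_const_mul]
  refine integral_mul_iteratedDeriv hB (hP α i) (hηi i) α fun j hj => ?_
  obtain ⟨h1, h2⟩ := hbd j (by omega)
  simp [← iteratedDeriv_pi_apply hη, h1, h2]

end Lagrangian

/-- The fundamental lemma of the calculus of variations on an interval, for continuous functions. -/
lemma eq_zero_on_Icc_of_integral_mul_eq_zero {h : ℝ → ℝ} (hh : Continuous h) {a b : ℝ} (hab : a < b)
    (H : ∀ g : ℝ → ℝ, ContDiff ℝ ∞ g → tsupport g ⊆ Ioo a b → ∫ s in a..b, h s * g s = 0) :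
    ∀ t ∈ Icc a b, h t = 0 := by
  have hae := isOpen_Ioo.ae_eq_zero_of_integral_contDiff_smul_eq_zero (μ := volume) (f := h)
    (U := Ioo a b) (hh.locallyIntegrable.locallyIntegrableOn _) fun g hg _ hgs => by
      rw [← H g hg hgs, intervalIntegral.integral_of_le hab.le]
      simp only [smul_eq_mul, mul_comm]
      refine (setIntegral_eq_integral_of_forall_compl_eq_zero fun s hs => ?_).symm
      rw [image_eq_zero_of_notMem_tsupport fun hs' => hs (Ioo_subset_Ioc_self (hgs hs')), mul_zero]
  have hIoo : EqOn h 0 (Ioo a b) :=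
    Measure.eqOn_open_of_ae_eq ((ae_restrict_iff' measurableSet_Ioo).2 hae) isOpen_Ioo
      hh.continuousOn continuousOn_const
  have := hIoo.closure hh continuous_const
  rwa [closure_Ioo hab.ne] at this

/-- Higher-order Herglotz variational principle (coordinates, `Q = ℝⁿ`). -/
theorem higher_order_herglotz_variational_principle
    {n k : ℕ} (L : (Fin (k+1) → Fin n → ℝ) → ℝ → ℝ) (hL : SmoothL L)
    (z₀ : ℝ) (Z : (ℝ → Fin n → ℝ) → ℝ → ℝ)
    (hZ : ∀ b : ℝ → Fin n → ℝ, ContDiff ℝ (⊤ : ℕ∞) b →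
      Z b 0 = z₀ ∧ ∀ t : ℝ, HasDerivAt (Z b) (L (jetk k b t) (Z b t)) t)
    (c : ℝ → Fin n → ℝ) (hc : ContDiff ℝ (⊤ : ℕ∞) c) :
    (∀ C : ℝ → ℝ → Fin n → ℝ,
      ContDiff ℝ (⊤ : ℕ∞) (fun p : ℝ × ℝ => C p.1 p.2) →
      C 0 = c →
      ContDiff ℝ (⊤ : ℕ∞) (fun p : ℝ × ℝ => Z (C p.1) p.2) →
      (∀ j : ℕ, j < k →
        deriv (fun lam => iteratedDeriv j (C lam) 0) 0 = 0 ∧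
        deriv (fun lam => iteratedDeriv j (C lam) 1) 0 = 0) →
      deriv (fun lam => Z (C lam) 1) 0 = 0)
    ↔
    (∀ t ∈ Set.Icc (0:ℝ) 1, ∀ i : Fin n,
      ∑ α ∈ Finset.range (k+1), (-1:ℝ)^α *
        ((fun f : ℝ → ℝ => fun s : ℝ =>
            deriv f s - pz (ext k L) (lift c s) (Z c s) * f s)^[α]
          (fun s : ℝ => pq (ext k L) α i (lift c s) (Z c s))) t = 0) := by
  let B : ℝ → ℝ := fun s => pz (ext k L) (lift c s) (Z c s)
  have hslice : ∀ {C : ℝ → ℝ → Fin n → ℝ}, ContDiff ℝ ∞ (fun p : ℝ × ℝ => C p.1 p.2) →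
      ∀ x, ContDiff ℝ ∞ (C x) := fun hC x => hC.comp (contDiff_prodMk_right x)
  have hZsmooth : ∀ C : ℝ → ℝ → Fin n → ℝ, ContDiff ℝ ∞ (fun p : ℝ × ℝ => C p.1 p.2) →
      ContDiff ℝ ∞ (fun p : ℝ × ℝ => Z (C p.1) p.2) := fun C hC =>
    contDiff_ode_solution (z := fun x => Z (C x)) (contDiff_lagrangian_family hL hC)
      (fun x => (hZ _ (hslice hC x)).1) fun x => (hZ _ (hslice hC x)).2
  have hz : ContDiff ℝ ∞ (Z c) :=
    (hZsmooth (fun _ => c) (hc.comp contDiff_snd)).comp (contDiff_prodMk_right (0 : ℝ))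
  have hvar : ∀ C : ℝ → ℝ → Fin n → ℝ, ContDiff ℝ ∞ (fun p : ℝ × ℝ => C p.1 p.2) → C 0 = c →
      (∀ j < k, iteratedDeriv j (fun s => deriv (fun x => C x s) 0) 0 = 0 ∧
        iteratedDeriv j (fun s => deriv (fun x => C x s) 0) 1 = 0) →
      deriv (fun x => Z (C x) 1) 0 = Real.exp (∫ s in 0..1, B s) *
        ∑ i, ∫ s in 0..1, Real.exp (-∫ r in 0..s, B r) *
          (herglotzExpr k L c (Z c) i s * deriv (fun x => C x s) 0 i) := by
    intro C hC hC0 hbd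
    have hη : ContDiff ℝ ∞ fun s => deriv (fun x => C x s) 0 :=
      (contDiff_deriv_fst hC).comp (contDiff_prodMk_right (0 : ℝ))
    rw [(hasDerivAt_action hL (Z := fun x => Z (C x)) hC (fun x => (hZ _ (hslice hC x)).1)
      (fun x => (hZ _ (hslice hC x)).2) 0 1).deriv, hC0, linearSolution,
      integral_variation_eq hL hc hz hη hbd]
  have hrhs : (∀ t ∈ Set.Icc (0:ℝ) 1, ∀ i, herglotzExpr k L c (Z c) i t = 0) ↔ _ :=
    forall₃_congr fun t _ i => by rw [herglotzExpr, Fin.sum_univ_eq_sum_range (fun α =>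
      (-1:ℝ) ^ α * (dampedDeriv B)^[α] (fun s => pq (ext k L) α i (lift c s) (Z c s)) t)]
  refine Iff.trans ⟨fun h => ?_, fun h => ?_⟩ hrhs
  · suffices ∀ i, ∀ t ∈ Icc (0:ℝ) 1,
        Real.exp (-∫ r in 0..t, B r) * herglotzExpr k L c (Z c) i t = 0 from fun t ht i =>
      (mul_eq_zero.1 (this i t ht)).resolve_left (Real.exp_ne_zero _)
    intro i
    refine eq_zero_on_Icc_of_integral_mul_eq_zero ?_ one_pos fun g hg hgs => ?_
    · exact (intervalIntegral.continuous_primitive (fun _ _ =>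
        (contDiff_pz_ext hL hc hz).continuous.intervalIntegrable _ _) _).neg.rexp.mul
          (contDiff_herglotzExpr hL hc hz i).continuous
    let C : ℝ → ℝ → Fin n → ℝ := fun x t => c t + (x * g t) • Pi.single i 1
    have hC : ContDiff ℝ ∞ (fun p : ℝ × ℝ => C p.1 p.2) :=
      (hc.comp contDiff_snd).add
        ((contDiff_fst.mul (hg.comp contDiff_snd)).smul contDiff_const)
    have hC0 : C 0 = c := by ext; simp [C]
    have hη : (fun s => deriv (fun x => C x s) 0) = fun s => g s • Pi.single i 1 := by
      ext1 s
      simpa [C] using ((((hasDerivAt_id (0:ℝ)).mul_const (g s)).smul_const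
        (Pi.single i (1:ℝ) : Fin n → ℝ)).const_add (c s)).deriv
    have hbd : ∀ (j : ℕ), ∀ t ∉ Ioo (0:ℝ) 1,
        iteratedDeriv j (fun s => deriv (fun x => C x s) 0) t = 0 := fun j t ht => by
      have hev : (fun s => g s • (Pi.single i 1 : Fin n → ℝ)) =ᶠ[𝓝 t] fun _ => 0 := by
        filter_upwards [notMem_tsupport_iff_eventuallyEq.1 fun h => ht (hgs h)] with s hs
        simp [hs]
      rw [hη, hev.iteratedDeriv_eq]
      simp
    have hzero := hvar C hC hC0 fun j _ => ⟨hbd j 0 (by simp), hbd j 1 (by simp)⟩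
    rw [h C hC hC0 (hZsmooth C hC) fun j _ => by
      simp only [(hasDerivAt_iteratedDeriv_snd hC j 0 _).deriv]
      exact ⟨hbd j 0 (by simp), hbd j 1 (by simp)⟩, eq_comm, mul_eq_zero,
      or_iff_right (Real.exp_ne_zero _), Finset.sum_eq_single i] at hzero
    · refine Eq.trans ?_ hzero
      simp [congrFun hη, mul_assoc]
    · intro i' _ hi'
      simp [congrFun hη, hi']
    · simp
  · intro C hC hC0 _ hbd
    simp only [(hasDerivAt_iteratedDeriv_snd hC _ 0 _).deriv] at hbd
    rw [hvar C hC hC0 hbd, Finset.sum_eq_zero, mul_zero]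
    intro i _
    rw [intervalIntegral.integral_congr (g := fun _ => 0), intervalIntegral.integral_zero]
    intro s hs
    rw [uIcc_of_le zero_le_one] at hs
    simp [h s hs i]

end HOC
end
end

section
/- Regularity of the Lagrangian is equivalent to the Legendre map being a local diffeomorphism (coordinate version): Let L be a Lagrangian of order k, and define the generalized Legendre map Leg : (ℝⁿ)^{2k} × ℝ → (ℝⁿ)^{2k} × ℝ by Leg(q₀,…,q_{2k−1},z) = (q₀,…,q_{k−1}, p̂⁰, p̂¹, …, p̂^{k−1}, z), where p̂ʳ = (p̂ʳ_i)_{i=1}^{n} are the Jacobi–Ostrogradskii momenta. Then Leg is a local diffeomorphism (its differential is invertible at every point) if and only if the Hessian matrix W_{ij} = ∂²L/∂q_k^i ∂q_k^j is invertible at every point of (ℝⁿ)^{k+1} × ℝ. -/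
open scoped BigOperators

noncomputable section

namespace HOC

open scoped ContDiff

/-- `F` is a smooth function of the coordinates `(q_α)_{α < m}` and `z`. -/
def IsOrd {n : ℕ} (m : ℕ) (F : Jet n → ℝ → ℝ) : Prop :=
  ∃ f : (Fin m → Fin n → ℝ) × ℝ → ℝ, ContDiff ℝ ∞ f ∧
    ∀ q z, F q z = f (fun α => q α.val, z)

namespace IsOrd

variable {n m : ℕ} {F G : Jet n → ℝ → ℝ}

theorem congr (hF : IsOrd m F) {q q' : Jet n} (h : ∀ α < m, q α = q' α) (z : ℝ) :
    F q z = F q' z := by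
  obtain ⟨f, -, hf⟩ := hF
  rw [hf, hf]
  congr 2
  funext α
  exact h α α.isLt

theorem mono (hF : IsOrd m F) {m' : ℕ} (h : m ≤ m') : IsOrd m' F := by
  obtain ⟨f, hf, hF⟩ := hF
  refine ⟨fun p => f (fun α => p.1 (Fin.castLE h α), p.2), hf.comp (by fun_prop), ?_⟩
  intro q z
  simp [hF]

theorem const (m : ℕ) (c : ℝ) : IsOrd (n := n) m (fun _ _ => c) :=
  ⟨fun _ => c, contDiff_const, fun _ _ => rfl⟩

theorem coord {α : ℕ} (h : α < m) (i : Fin n) : IsOrd m (fun q _ => q α i) :=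
  ⟨fun p => p.1 ⟨α, h⟩ i, by fun_prop, fun _ _ => rfl⟩

theorem add (hF : IsOrd m F) (hG : IsOrd m G) : IsOrd m (fun q z => F q z + G q z) := by
  obtain ⟨f, hf, hF⟩ := hF
  obtain ⟨g, hg, hG⟩ := hG
  exact ⟨fun p => f p + g p, hf.add hg, fun q z => by simp only [hF, hG]⟩

theorem sub (hF : IsOrd m F) (hG : IsOrd m G) : IsOrd m (fun q z => F q z - G q z) := by
  obtain ⟨f, hf, hF⟩ := hF
  obtain ⟨g, hg, hG⟩ := hG
  exact ⟨fun p => f p - g p, hf.sub hg, fun q z => by simp only [hF, hG]⟩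

theorem mul (hF : IsOrd m F) (hG : IsOrd m G) : IsOrd m (fun q z => F q z * G q z) := by
  obtain ⟨f, hf, hF⟩ := hF
  obtain ⟨g, hg, hG⟩ := hG
  exact ⟨fun p => f p * g p, hf.mul hg, fun q z => by simp only [hF, hG]⟩

theorem sum {ι : Type*} (s : Finset ι) {F : ι → Jet n → ℝ → ℝ} (hF : ∀ a ∈ s, IsOrd m (F a)) :
    IsOrd m (fun q z => ∑ a ∈ s, F a q z) := by
  classical
  induction s using Finset.induction_on with
  | empty => simpa using const m 0
  | insert a s ha ih =>
    simp only [Finset.sum_insert ha]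
    exact (hF a (by simp)).add (ih fun b hb => hF b (by simp [hb]))

end IsOrd

section Partial

variable {n m : ℕ} {F : Jet n → ℝ → ℝ}

theorem hasDerivAt_of_fderiv {f : (Fin m → Fin n → ℝ) × ℝ → ℝ} (hf : ContDiff ℝ ∞ f)
    (hF : ∀ q z, F q z = f (fun α => q α.val, z)) (α : Fin m) (i : Fin n) (q : Jet n) (z : ℝ) :
    HasDerivAt (fun s : ℝ => F (Function.update q α (Function.update (q α) i s)) z)
      (fderiv ℝ f (fun α => q α.val, z) (Pi.single α (Pi.single i 1), 0)) (q α i) := by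
  have hcurve : (fun s : ℝ => F (Function.update q α (Function.update (q α) i s)) z) =
      f ∘ fun s : ℝ => ((fun β : Fin m => q β.val, z) : (Fin m → Fin n → ℝ) × ℝ) +
        (s - q α i) • (Pi.single α (Pi.single i 1), 0) := by
    funext s
    rw [hF]
    simp only [Function.comp_apply]
    congr 1
    refine Prod.ext ?_ (by simp)
    funext β j
    by_cases hβ : β = α
    · subst hβ
      by_cases hj : j = i
      · subst hj; simp
      · simp [hj]
    · have : (β : ℕ) ≠ α := fun h => hβ (Fin.ext h)
      simp [hβ, this]
  rw [hcurve]
  have hc : HasDerivAt (fun s : ℝ => ((fun β : Fin m => q β.val, z) : (Fin m → Fin n → ℝ) × ℝ) +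
      (s - q α i) • ((Pi.single α (Pi.single i 1), 0) : (Fin m → Fin n → ℝ) × ℝ))
      (Pi.single α (Pi.single i 1), 0) (q α i) := by
    simpa using (((hasDerivAt_id (q α i)).sub_const (q α i)).smul_const
      ((Pi.single α (Pi.single i 1), 0) : (Fin m → Fin n → ℝ) × ℝ)).const_add
      ((fun β : Fin m => q β.val, z) : (Fin m → Fin n → ℝ) × ℝ)
  refine HasFDerivAt.comp_hasDerivAt (q α i) ?_ hc
  simpa using (hf.differentiable (by simp) (fun α : Fin m => q α.val, z)).hasFDerivAt

theorem pq_eq_fderiv {f : (Fin m → Fin n → ℝ) × ℝ → ℝ} (hf : ContDiff ℝ ∞ f)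
    (hF : ∀ q z, F q z = f (fun α => q α.val, z)) (α : Fin m) (i : Fin n) (q : Jet n) (z : ℝ) :
    pq F α i q z = fderiv ℝ f (fun α => q α.val, z) (Pi.single α (Pi.single i 1), 0) :=
  (hasDerivAt_of_fderiv hf hF α i q z).deriv

theorem pz_eq_fderiv {f : (Fin m → Fin n → ℝ) × ℝ → ℝ} (hf : ContDiff ℝ ∞ f)
    (hF : ∀ q z, F q z = f (fun α => q α.val, z)) (q : Jet n) (z : ℝ) :
    pz F q z = fderiv ℝ f (fun α => q α.val, z) (0, 1) := by
  have hc : HasDerivAt (fun w : ℝ => ((fun β : Fin m => q β.val, w) : (Fin m → Fin n → ℝ) × ℝ))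
      (0, 1) z := (hasDerivAt_const z _).prodMk (hasDerivAt_id z)
  have h := HasFDerivAt.comp_hasDerivAt z
    (hf.differentiable (by simp) (fun α : Fin m => q α.val, z)).hasFDerivAt hc
  have hfun : (fun w => F q w) = f ∘ fun w : ℝ => (fun β : Fin m => q β.val, w) := by
    funext w
    exact hF q w
  rw [pz, hfun]
  exact h.deriv

theorem update_const (hF : IsOrd m F) {α : ℕ} (h : m ≤ α) (q : Jet n) (x : Fin n → ℝ) (z : ℝ) :
    F (Function.update q α x) z = F q z :=
  hF.congr (fun β hβ => Function.update_of_ne (by omega) _ _) z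

theorem pq_eq_zero (hF : IsOrd m F) {α : ℕ} (h : m ≤ α) (i : Fin n) (q : Jet n) (z : ℝ) :
    pq F α i q z = 0 := by
  simp [pq, update_const hF h]

theorem hasDerivAt_pq (hF : IsOrd m F) (α : ℕ) (i : Fin n) (q : Jet n) (z : ℝ) :
    HasDerivAt (fun s : ℝ => F (Function.update q α (Function.update (q α) i s)) z)
      (pq F α i q z) (q α i) := by
  by_cases h : α < m
  · obtain ⟨f, hf, hF⟩ := hF
    exact (hasDerivAt_of_fderiv hf hF ⟨α, h⟩ i q z).differentiableAt.hasDerivAt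
  · simp only [pq_eq_zero hF (not_lt.1 h), update_const hF (not_lt.1 h)]
    exact hasDerivAt_const _ _

theorem IsOrd.pq (hF : IsOrd m F) (α : ℕ) (i : Fin n) : IsOrd m (pq F α i) := by
  by_cases h : α < m
  · obtain ⟨f, hf, hF⟩ := hF
    exact ⟨fun p => fderiv ℝ f p (Pi.single ⟨α, h⟩ (Pi.single i 1), 0),
      (hf.fderiv_right (by simp)).clm_apply contDiff_const,
      fun q z => pq_eq_fderiv hf hF ⟨α, h⟩ i q z⟩
  · have : HOC.pq F α i = fun _ _ => 0 := by
      funext q z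
      exact pq_eq_zero hF (not_lt.1 h) i q z
    rw [this]
    exact const m 0

theorem IsOrd.pz (hF : IsOrd m F) : IsOrd m (pz F) := by
  obtain ⟨f, hf, hF⟩ := hF
  exact ⟨fun p => fderiv ℝ f p (0, 1), (hf.fderiv_right (by simp)).clm_apply contDiff_const,
    fun q z => pz_eq_fderiv hf hF q z⟩

end Partial

section TotalDerivative

variable {n r : ℕ} {Lx F : Jet n → ℝ → ℝ}

theorem DL_eq (Lx F : Jet n → ℝ → ℝ) (r : ℕ) (q : Jet n) (z : ℝ) :
    DL Lx r F q z = ∑ j : Fin n, q (r+1) j * pq F r j q z +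
      ((∑ α ∈ Finset.range r, ∑ i : Fin n, q (α+1) i * pq F α i q z)
        + Lx q z * pz F q z - pz Lx q z * F q z) := by
  rw [DL, Finset.sum_range_succ]
  ring

theorem isOrd_DL_remainder (hLx : IsOrd (r+1) Lx) (hF : IsOrd (r+1) F) :
    IsOrd (r+1) (fun q z => (∑ α ∈ Finset.range r, ∑ i : Fin n, q (α+1) i * pq F α i q z)
        + Lx q z * pz F q z - pz Lx q z * F q z) := by
  refine ((IsOrd.sum _ fun α hα => IsOrd.sum _ fun i _ => ?_).add (hLx.mul hF.pz)).sub
    (hLx.pz.mul hF)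
  have := Finset.mem_range.1 hα
  exact (IsOrd.coord (by omega) i).mul (hF.pq α i)

theorem IsOrd.DL (hLx : IsOrd (r+1) Lx) (hF : IsOrd (r+1) F) : IsOrd (r+2) (DL Lx r F) := by
  have : HOC.DL Lx r F = fun q z => _ := funext fun q => funext fun z => DL_eq Lx F r q z
  rw [this]
  refine (IsOrd.sum _ fun j _ => ?_).add ((isOrd_DL_remainder hLx hF).mono (by omega))
  exact (IsOrd.coord (by omega) j).mul ((hF.pq r j).mono (by omega))

/-- The derivative of `D_L F` in the top coordinate is that of `F` one order lower. -/
theorem pq_DL_top (hLx : IsOrd (r+1) Lx) (hF : IsOrd (r+1) F) (i : Fin n) (q : Jet n) (z : ℝ) :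
    pq (DL Lx r F) (r+1) i q z = pq F r i q z := by
  have hcurve : (fun s : ℝ =>
      DL Lx r F (Function.update q (r+1) (Function.update (q (r+1)) i s)) z) =
      fun s => ∑ j : Fin n, Function.update (q (r+1)) i s j * pq F r j q z +
        ((∑ α ∈ Finset.range r, ∑ i : Fin n, q (α+1) i * pq F α i q z)
          + Lx q z * pz F q z - pz Lx q z * F q z) := by
    funext s
    rw [DL_eq]
    have h := update_const (isOrd_DL_remainder hLx hF) le_rfl q (Function.update (q (r+1)) i s) z
    rw [h]
    simp only [update_const (hF.pq r _) le_rfl, Function.update_self]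
  rw [pq, hcurve]
  refine HasDerivAt.deriv (HasDerivAt.add_const _ ?_)
  have h : HasDerivAt (fun s : ℝ => ∑ j : Fin n, Function.update (q (r+1)) i s j * pq F r j q z)
      (∑ j : Fin n, (Pi.single i (1 : ℝ) : Fin n → ℝ) j * pq F r j q z) (q (r+1) i) :=
    HasDerivAt.fun_sum fun j _ =>
      (hasDerivAt_pi.1 (hasDerivAt_update (q (r+1)) i (q (r+1) i)) j).mul_const _
  simpa [Pi.single_apply] using h

theorem IsOrd.DLpow (hLx : IsOrd (r+1) Lx) (hF : IsOrd (r+1) F) (α : ℕ) :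
    IsOrd (r+α+1) (DLpow Lx r α F) := by
  induction α with
  | zero => exact hF
  | succ α ih => exact IsOrd.DL (r := r+α) (hLx.mono (by omega)) ih

theorem pq_DLpow_top (hLx : IsOrd (r+1) Lx) (hF : IsOrd (r+1) F) (α : ℕ) (i : Fin n) (q : Jet n)
    (z : ℝ) : pq (DLpow Lx r α F) (r+α) i q z = pq F r i q z := by
  induction α with
  | zero => rfl
  | succ α ih =>
    rw [← ih]
    exact pq_DL_top (r := r+α) (hLx.mono (by omega)) (IsOrd.DLpow hLx hF α) i q z

end TotalDerivative

section Momentum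

variable {n k : ℕ} {L : (Fin (k+1) → Fin n → ℝ) → ℝ → ℝ}

theorem SmoothL.isOrd_ext (hL : SmoothL L) : IsOrd (k+1) (ext k L) :=
  ⟨_, hL, fun _ _ => rfl⟩

theorem isOrd_momentum (hL : SmoothL L) {r : ℕ} (hr : r ≤ k) (i : Fin n) :
    IsOrd (2*k-r+1) (momentum k L r i) := by
  refine IsOrd.sum _ fun α hα => (IsOrd.const _ _).mul ?_
  have := Finset.mem_range.1 hα
  exact (IsOrd.DLpow hL.isOrd_ext (hL.isOrd_ext.pq _ _) α).mono (by omega)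

theorem pq_momentum_top (hL : SmoothL L) {r : ℕ} (hr : r ≤ k) (i j : Fin n) (q : Jet n) (z : ℝ) :
    pq (momentum k L r i) (2*k-r) j q z =
      (-1)^(k-r) * pq (pq (ext k L) k i) k j q z := by
  have hord (α : ℕ) := IsOrd.DLpow hL.isOrd_ext (hL.isOrd_ext.pq (r+α) i) α
  have h : HasDerivAt (fun s : ℝ => momentum k L r i
      (Function.update q (2*k-r) (Function.update (q (2*k-r)) j s)) z)
      (∑ α ∈ Finset.range (k-r+1), (-1)^α *
        pq (DLpow (ext k L) k α (pq (ext k L) (r+α) i)) (2*k-r) j q z) (q (2*k-r) j) :=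
    HasDerivAt.fun_sum fun α _ => (hasDerivAt_pq (hord α) (2*k-r) j q z).const_mul _
  rw [pq, h.deriv, Finset.sum_range_succ, Finset.sum_eq_zero, zero_add]
  · have h1 : 2*k-r = k+(k-r) := by omega
    have h2 : r+(k-r) = k := by omega
    rw [h1, pq_DLpow_top hL.isOrd_ext (hL.isOrd_ext.pq _ i), h2]
  · intro α hα
    have := Finset.mem_range.1 hα
    rw [pq_eq_zero (hord α) (by omega), mul_zero]

end Momentum

section Legendre

variable {n k : ℕ} {L : (Fin (k+1) → Fin n → ℝ) → ℝ → ℝ}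

theorem restrict_padJet {m : ℕ} (q : Fin m → Fin n → ℝ) : (fun α : Fin m => padJet m q α) = q := by
  funext α
  simp [padJet]

/-- Chain rule for a function of `(q_α)_{α < m}` and `z` in terms of its partial derivatives. -/
theorem hasFDerivAt_padJet {m : ℕ} {F : Jet n → ℝ → ℝ} (hF : IsOrd m F)
    (w : (Fin m → Fin n → ℝ) × ℝ) :
    ∃ D : (Fin m → Fin n → ℝ) × ℝ →L[ℝ] ℝ,
      HasFDerivAt (fun w : (Fin m → Fin n → ℝ) × ℝ => F (padJet m w.1) w.2) D w ∧
      ∀ v, D v = ∑ α : Fin m, ∑ j : Fin n, v.1 α j * pq F α j (padJet m w.1) w.2 +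
        v.2 * pz F (padJet m w.1) w.2 := by
  obtain ⟨f, hf, hF⟩ := hF
  refine ⟨fderiv ℝ f w, ?_, fun v => ?_⟩
  · simpa only [hF, restrict_padJet] using (hf.differentiable (by simp) w).hasFDerivAt
  · have hv : v = ∑ α : Fin m, ∑ j : Fin n,
        v.1 α j • ((Pi.single α (Pi.single j 1), 0) : (Fin m → Fin n → ℝ) × ℝ) +
        v.2 • (0, 1) := by
      refine Prod.ext ?_ ?_
      · funext β l
        simp [Prod.fst_sum, Finset.sum_apply, Pi.single_apply, apply_ite]
      · simp [Prod.snd_sum]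
    conv_lhs => rw [hv]
    simp only [pq_eq_fderiv hf hF, pz_eq_fderiv hf hF, restrict_padJet, map_add, map_sum, map_smul,
      smul_eq_mul]

theorem fderiv_Leg (hL : SmoothL L) (w v : (Fin (2*k) → Fin n → ℝ) × ℝ) :
    (∀ (β : Fin (2*k)) (i : Fin n), (fderiv ℝ (Leg k L) w v).1 β i =
      if (β : ℕ) < k then v.1 β i else
        ∑ γ : Fin (2*k), ∑ j : Fin n,
          v.1 γ j * pq (momentum k L (β-k+1) i) γ j (padJet (2*k) w.1) w.2 +
        v.2 * pz (momentum k L (β-k+1) i) (padJet (2*k) w.1) w.2) ∧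
    (fderiv ℝ (Leg k L) w v).2 = v.2 := by
  have hcomp : ∀ (β : Fin (2*k)) (i : Fin n), ∃ D : (Fin (2*k) → Fin n → ℝ) × ℝ →L[ℝ] ℝ,
      HasFDerivAt (fun w => (Leg k L w).1 β i) D w ∧
      ∀ v, D v = if (β : ℕ) < k then v.1 β i else
        ∑ γ : Fin (2*k), ∑ j : Fin n,
          v.1 γ j * pq (momentum k L (β-k+1) i) γ j (padJet (2*k) w.1) w.2 +
        v.2 * pz (momentum k L (β-k+1) i) (padJet (2*k) w.1) w.2 := by
    intro β i
    by_cases hβ : (β : ℕ) < k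
    · simp only [Leg, hβ, if_true]
      let D : (Fin (2*k) → Fin n → ℝ) × ℝ →L[ℝ] ℝ :=
        (ContinuousLinearMap.proj (R := ℝ) (φ := fun _ : Fin n => ℝ) i).comp
          ((ContinuousLinearMap.proj (R := ℝ) (φ := fun _ : Fin (2*k) => Fin n → ℝ) β).comp
            (ContinuousLinearMap.fst ℝ _ _))
      exact ⟨D, D.hasFDerivAt, fun _ => rfl⟩
    · simp only [Leg, hβ, if_false]
      have := β.isLt
      exact hasFDerivAt_padJet ((isOrd_momentum hL (by omega) i).mono (by omega)) w
  choose D hD hDv using hcomp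
  have h1 : HasFDerivAt (fun w => (Leg k L w).1)
      (ContinuousLinearMap.pi fun β => ContinuousLinearMap.pi fun i => D β i) w :=
    hasFDerivAt_pi.2 fun β => hasFDerivAt_pi.2 fun i => hD β i
  have h : HasFDerivAt (Leg k L) _ w := h1.prodMk hasFDerivAt_snd
  rw [h.fderiv]
  exact ⟨fun β i => hDv β i v, rfl⟩

/-- If `v` vanishes in all coordinates before `μ`, the component of `D Leg · v` at
`β = 3k - 1 - μ` is the Hessian applied to `v_μ`, up to sign. -/
theorem fderiv_Leg_of_eq_zero (hL : SmoothL L) (w v : (Fin (2*k) → Fin n → ℝ) × ℝ)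
    (hz : v.2 = 0) {μ β : Fin (2*k)} (hβ : k ≤ (β : ℕ)) (hμ : (μ : ℕ) + β + 1 = 3 * k)
    (hv : ∀ γ < μ, v.1 γ = 0) (i : Fin n) :
    (fderiv ℝ (Leg k L) w v).1 β i = (-1)^((μ : ℕ) - k) *
      Matrix.vecMul (v.1 μ) (Matrix.of fun i j : Fin n =>
        pq (pq (ext k L) k j) k i (padJet (2*k) w.1) w.2) i := by
  have := β.isLt
  have hr : (β : ℕ) - k + 1 ≤ k := by omega
  have htop : 2*k - ((β : ℕ) - k + 1) = μ := by omega
  have hexp : k - ((β : ℕ) - k + 1) = μ - k := by omega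
  rw [(fderiv_Leg hL w v).1, if_neg (by omega), hz, zero_mul, add_zero,
    Finset.sum_eq_single μ]
  · simp only [Matrix.vecMul, dotProduct, Matrix.of_apply, Finset.mul_sum]
    refine Finset.sum_congr rfl fun j _ => ?_
    have h := pq_momentum_top hL hr i j (padJet (2*k) w.1) w.2
    rw [htop, hexp] at h
    rw [h]
    ring
  · intro γ _ hγ
    rcases lt_or_gt_of_ne hγ with h | h
    · simp [hv γ h]
    · refine Finset.sum_eq_zero fun j _ => ?_
      have : (μ : ℕ) < γ := h
      rw [pq_eq_zero (isOrd_momentum hL hr i) (by omega), mul_zero]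
  · simp

/-- At each point, invertibility of the differential of `Leg` is invertibility of the Hessian. -/
theorem isUnit_fderiv_Leg_iff (hk : 1 ≤ k) (hL : SmoothL L)
    (w : (Fin (2*k) → Fin n → ℝ) × ℝ) :
    IsUnit (fderiv ℝ (Leg k L) w) ↔ IsUnit (Matrix.of fun i j : Fin n =>
      pq (pq (ext k L) k j) k i (padJet (2*k) w.1) w.2) := by
  rw [← Matrix.vecMul_injective_iff_isUnit, ContinuousLinearMap.isUnit_iff_bijective]
  constructor
  · intro hbij
    refine (injective_iff_map_eq_zero (Matrix.vecMulLinear (Matrix.of fun i j : Fin n =>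
      pq (pq (ext k L) k j) k i (padJet (2*k) w.1) w.2))).2 ?_
    intro u hu
    let μ : Fin (2*k) := ⟨2*k-1, by omega⟩
    have h0 : fderiv ℝ (Leg k L) w (Pi.single μ u, 0) = 0 := by
      refine Prod.ext ?_ (fderiv_Leg hL w _).2
      funext β i
      by_cases hβ : (β : ℕ) < k
      · have : β ≠ μ := fun h => by
          have : (β : ℕ) = 2*k-1 := congrArg Fin.val h
          omega
        rw [(fderiv_Leg hL w _).1, if_pos hβ]
        simp [this]
      · by_cases hβk : (β : ℕ) = k
        · rw [fderiv_Leg_of_eq_zero hL w (Pi.single μ u, 0) rfl (μ := μ) (by omega)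
            (by simp only [μ]; omega) (fun γ hγ => by simp [hγ.ne])]
          simpa using congrFun hu i
        · have hlt := β.isLt
          rw [fderiv_Leg_of_eq_zero hL w (Pi.single μ u, 0) rfl (μ := ⟨3*k-1-β, by omega⟩)
            (by omega) (by simp only; omega) (fun γ hγ => by
              have hγ' : (γ : ℕ) < 3*k-1-β := hγ
              have : γ ≠ μ := fun h => by
                have : (γ : ℕ) = 2*k-1 := congrArg Fin.val h
                omega
              simp [this])]
          have : (⟨3*k-1-β, by omega⟩ : Fin (2*k)) ≠ μ := fun h => by
            have : 3*k-1-(β : ℕ) = 2*k-1 := congrArg Fin.val h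
            omega
          simp [this]
    have h := (injective_iff_map_eq_zero _).1 hbij.1 _ h0
    simpa using congrFun (congrArg Prod.fst h) μ
  · intro hW
    have hinj : Function.Injective (fderiv ℝ (Leg k L) w) := by
      rw [injective_iff_map_eq_zero]
      intro v hv
      have hz : v.2 = 0 := by rw [← (fderiv_Leg hL w v).2, hv]; rfl
      have hall : ∀ (m : ℕ) (hm : m < 2*k), v.1 ⟨m, hm⟩ = 0 := by
        intro m
        induction m using Nat.strong_induction_on with
        | _ m ih =>
          intro hm
          by_cases hmk : m < k
          · funext i
            have h := (fderiv_Leg hL w v).1 ⟨m, hm⟩ i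
            rw [if_pos hmk, hv] at h
            exact h.symm
          · apply hW
            simp only [Matrix.zero_vecMul]
            funext i
            have h := fderiv_Leg_of_eq_zero hL w v hz (μ := ⟨m, hm⟩) (β := ⟨3*k-1-m, by omega⟩)
              (by simp only; omega) (by simp only; omega) (fun γ hγ => ih γ hγ γ.isLt) i
            rw [hv] at h
            simpa using h
      exact Prod.ext (funext fun γ => hall γ γ.isLt) hz
    exact ⟨hinj, LinearMap.injective_iff_surjective
      (f := (fderiv ℝ (Leg k L) w).toLinearMap).1 hinj⟩

end Legendre

/-- Regularity of `L` is equivalent to the Legendre map being a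
local diffeomorphism (its differential is invertible at every point). -/
theorem regular_iff_legendre_local_diffeo
    {n k : ℕ} (hk : 1 ≤ k)
    (L : (Fin (k+1) → Fin n → ℝ) → ℝ → ℝ) (hL : SmoothL L) :
    (∀ w : (Fin (2*k) → Fin n → ℝ) × ℝ, IsUnit (fderiv ℝ (Leg k L) w))
    ↔ (∀ (Q : Fin (k+1) → Fin n → ℝ) (z : ℝ),
        IsUnit (Matrix.of fun i j : Fin n =>
          pq (fun q' z' => pq (ext k L) k j q' z') k i (padJet (k+1) Q) z)) := by
  have hW (i j : Fin n) : IsOrd (k+1) (pq (pq (ext k L) k j) k i) :=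
    (hL.isOrd_ext.pq k j).pq k i
  simp only [isUnit_fderiv_Leg_iff hk hL]
  constructor
  · intro h Q z
    have hpad : padJet (2*k) (fun α : Fin (2*k) => padJet (k+1) Q α) = padJet (k+1) Q := by
      funext α
      by_cases hα : α < 2*k
      · simp [padJet, hα]
      · have : ¬ α < k+1 := by omega
        simp [padJet, hα, this]
    simpa only [hpad] using h (fun α => padJet (k+1) Q α, z)
  · intro h w
    have hpad : ∀ α < k+1,
        padJet (k+1) (fun α : Fin (k+1) => padJet (2*k) w.1 α) α = padJet (2*k) w.1 α :=
      fun α hα => by simp [padJet, hα]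
    simpa only [fun i j => (hW i j).congr hpad w.2] using
      h (fun α : Fin (k+1) => padJet (2*k) w.1 α) w.2

end HOC
end
end

section
/- Evolution of the Jacobi–Ostrogradskii momenta along Herglotz solutions (Hamiltonian equations on the Legendre image): Let L be a Lagrangian of order k and let (c, z) be a smooth pair with z′(t) = L(c̄ᵏ(t), z(t)) satisfying the 2k-th order Herglotz equations. Define Pʳ_i(t) = p̂ʳ_i(c̄^{2k−1}(t), z(t)) for 0 ≤ r ≤ k−1. Then for all t and all i: (d/dt)P⁰_i = (∂L/∂q₀^i)(c̄ᵏ(t), z(t)) + P⁰_i(t)·(∂L/∂z)(c̄ᵏ(t), z(t)), and for 1 ≤ r ≤ k−1, (d/dt)Pʳ_i = −P^{r−1}_i(t) + (∂L/∂q_r^i)(c̄ᵏ(t), z(t)) + Pʳ_i(t)·(∂L/∂z)(c̄ᵏ(t), z(t)). -/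
open scoped BigOperators

noncomputable section

namespace HOC

/-- A jet function is smooth of order `r` if it is a smooth function of `(q₀,…,q_r,z)`. -/
def IsSmoothOfOrder {n : ℕ} (r : ℕ) (F : Jet n → ℝ → ℝ) : Prop :=
  ∃ G : (Fin (r+1) → Fin n → ℝ) → ℝ → ℝ, SmoothL G ∧ F = ext r G

namespace IsSmoothOfOrder

variable {n r : ℕ} {F H : Jet n → ℝ → ℝ}

theorem mono {r' : ℕ} (h : r ≤ r') (hF : IsSmoothOfOrder r F) : IsSmoothOfOrder r' F := by
  obtain ⟨G, hG, rfl⟩ := hF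
  refine ⟨fun q z => G (fun α => q ⟨α.val, by omega⟩) z, ?_, rfl⟩
  have h1 : ContDiff ℝ (⊤ : ℕ∞) (fun p : (Fin (r'+1) → Fin n → ℝ) × ℝ =>
      ((fun α : Fin (r+1) => p.1 ⟨α.val, by omega⟩), p.2)) := by
    fun_prop
  exact ContDiff.comp hG h1

theorem zero : IsSmoothOfOrder r (fun (_ : Jet n) _ => 0) :=
  ⟨fun _ _ => 0, contDiff_const, rfl⟩

theorem add (hF : IsSmoothOfOrder r F) (hH : IsSmoothOfOrder r H) :
    IsSmoothOfOrder r (fun q z => F q z + H q z) := by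
  obtain ⟨G, hG, rfl⟩ := hF
  obtain ⟨G', hG', rfl⟩ := hH
  exact ⟨fun q z => G q z + G' q z, ContDiff.add hG hG', rfl⟩

theorem sub (hF : IsSmoothOfOrder r F) (hH : IsSmoothOfOrder r H) :
    IsSmoothOfOrder r (fun q z => F q z - H q z) := by
  obtain ⟨G, hG, rfl⟩ := hF
  obtain ⟨G', hG', rfl⟩ := hH
  exact ⟨fun q z => G q z - G' q z, ContDiff.sub hG hG', rfl⟩

theorem mul (hF : IsSmoothOfOrder r F) (hH : IsSmoothOfOrder r H) :
    IsSmoothOfOrder r (fun q z => F q z * H q z) := by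
  obtain ⟨G, hG, rfl⟩ := hF
  obtain ⟨G', hG', rfl⟩ := hH
  exact ⟨fun q z => G q z * G' q z, ContDiff.mul hG hG', rfl⟩

theorem sum {ι : Type*} (s : Finset ι) {F : ι → Jet n → ℝ → ℝ}
    (hF : ∀ j ∈ s, IsSmoothOfOrder r (F j)) :
    IsSmoothOfOrder r (fun q z => ∑ j ∈ s, F j q z) := by
  classical
  induction s using Finset.induction_on with
  | empty => simpa using zero
  | insert a s ha ih =>
    simp only [Finset.sum_insert ha]
    exact (hF a (by simp)).add (ih fun j hj => hF j (by simp [hj]))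

theorem coord {α : ℕ} (h : α ≤ r) (i : Fin n) : IsSmoothOfOrder r (fun q _ => q α i) := by
  refine ⟨fun q _ => q ⟨α, by omega⟩ i, ?_, rfl⟩
  unfold SmoothL
  fun_prop

end IsSmoothOfOrder

section Partials

variable {n r : ℕ} {G : (Fin (r+1) → Fin n → ℝ) → ℝ → ℝ}

theorem SmoothL.hasFDerivAt (hG : SmoothL G) (p : (Fin (r+1) → Fin n → ℝ) × ℝ) :
    HasFDerivAt (fun p : (Fin (r+1) → Fin n → ℝ) × ℝ => G p.1 p.2)
      (fderiv ℝ (fun p : (Fin (r+1) → Fin n → ℝ) × ℝ => G p.1 p.2) p) p :=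
  (ContDiff.differentiable hG (by simp)).differentiableAt.hasFDerivAt

theorem pq_ext (hG : SmoothL G) (α : Fin (r+1)) (i : Fin n) (q : Jet n) (z : ℝ) :
    pq (ext r G) α i q z =
      fderiv ℝ (fun p : (Fin (r+1) → Fin n → ℝ) × ℝ => G p.1 p.2) (fun β => q β, z)
        (Pi.single α (Pi.single i 1), 0) := by
  have hinner : HasDerivAt (fun s : ℝ => Function.update (q α) i s) (Pi.single i 1) (q α i) :=
    hasDerivAt_update _ _ _
  have hcurve : HasDerivAt
      (fun s : ℝ => fun β : Fin (r+1) => Function.update q α (Function.update (q α) i s) β)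
      (Pi.single α (Pi.single i 1)) (q α i) := by
    rw [hasDerivAt_pi]
    intro β
    rcases eq_or_ne β α with rfl | hβ
    · simpa using hinner
    · have hβ' : (β : ℕ) ≠ α := fun h => hβ (Fin.ext h)
      simpa [hβ, hβ'] using hasDerivAt_const (q α i) (q β)
  have hpair := hcurve.prodMk (hasDerivAt_const (q α i) z)
  have hbase : (fun β : Fin (r+1) =>
      Function.update q α (Function.update (q α) i (q α i)) β) = fun β : Fin (r+1) => q β := by
    simp
  have hF := hG.hasFDerivAt
    (fun β : Fin (r+1) => Function.update q α (Function.update (q α) i (q α i)) β, z)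
  have key := hF.comp_hasDerivAt (q α i) hpair
  rw [hbase] at key
  exact key.deriv

theorem pq_ext_of_lt {α : ℕ} (h : r < α) (i : Fin n) (q : Jet n) (z : ℝ) :
    pq (ext r G) α i q z = 0 := by
  have hne : ∀ β : Fin (r+1), (β : ℕ) ≠ α := fun β => by omega
  simp [pq, ext, hne]

theorem pz_ext (hG : SmoothL G) (q : Jet n) (z : ℝ) :
    pz (ext r G) q z =
      fderiv ℝ (fun p : (Fin (r+1) → Fin n → ℝ) × ℝ => G p.1 p.2) (fun β => q β, z) (0, 1) :=
  ((hG.hasFDerivAt _).comp_hasDerivAt z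
    ((hasDerivAt_const z fun β : Fin (r+1) => q β).prodMk (hasDerivAt_id z))).deriv

theorem SmoothL.fderiv_apply (hG : SmoothL G) (v : (Fin (r+1) → Fin n → ℝ) × ℝ) :
    SmoothL (fun q z =>
      fderiv ℝ (fun p : (Fin (r+1) → Fin n → ℝ) × ℝ => G p.1 p.2) (q, z) v) :=
  ContDiff.clm_apply (ContDiff.fderiv_right hG (by simp)) contDiff_const

end Partials

namespace IsSmoothOfOrder

variable {n r k : ℕ} {F Lx : Jet n → ℝ → ℝ}

theorem pq (hF : IsSmoothOfOrder r F) (α : ℕ) (i : Fin n) :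
    IsSmoothOfOrder r (pq F α i) := by
  obtain ⟨G, hG, rfl⟩ := hF
  rcases Nat.lt_or_ge r α with h | h
  · convert zero using 1
    ext q z
    exact pq_ext_of_lt h i q z
  · refine ⟨_, hG.fderiv_apply (Pi.single ⟨α, by omega⟩ (Pi.single i 1), 0), ?_⟩
    ext q z
    exact pq_ext hG ⟨α, by omega⟩ i q z

theorem pz (hF : IsSmoothOfOrder r F) : IsSmoothOfOrder r (pz F) := by
  obtain ⟨G, hG, rfl⟩ := hF
  refine ⟨_, hG.fderiv_apply (0, 1), ?_⟩
  ext q z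
  exact pz_ext hG q z

theorem DL (hL : IsSmoothOfOrder k Lx) (hkr : k ≤ r) (hF : IsSmoothOfOrder r F) :
    IsSmoothOfOrder (r+1) (DL Lx r F) := by
  have hL' : IsSmoothOfOrder (r+1) Lx := hL.mono (by omega)
  have hF' : IsSmoothOfOrder (r+1) F := hF.mono (by omega)
  refine ((sum _ fun α hα => sum _ fun i _ => ?_).add (hL'.mul hF'.pz)).sub (hL'.pz.mul hF')
  have hα' := Finset.mem_range.mp hα
  exact (coord (by omega) i).mul (hF'.pq α i)

theorem DLpow (hL : IsSmoothOfOrder k Lx) (hF : IsSmoothOfOrder k F) (α : ℕ) :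
    IsSmoothOfOrder (k+α) (DLpow Lx k α F) := by
  induction α with
  | zero => exact hF
  | succ α ih => exact DL hL (Nat.le_add_right k α) ih

end IsSmoothOfOrder

theorem hasDerivAt_jetk_s12 {n : ℕ} {c : ℝ → Fin n → ℝ} (hc : ContDiff ℝ (⊤ : ℕ∞) c) (r : ℕ) (t : ℝ) :
    HasDerivAt (jetk r c) (fun α => lift c t (α + 1)) t := by
  rw [hasDerivAt_pi]
  intro α
  have hd : Differentiable ℝ (iteratedDeriv α c) :=
    hc.differentiable_iteratedDeriv α (by exact_mod_cast ENat.natCast_lt_top _)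
  simpa [jetk, lift, iteratedDeriv_succ] using (hd t).hasDerivAt

theorem map_prod_pi_eq_sum {n r : ℕ} (A : ((Fin (r+1) → Fin n → ℝ) × ℝ) →L[ℝ] ℝ)
    (v : Fin (r+1) → Fin n → ℝ) (w : ℝ) :
    A (v, w) = (∑ α, ∑ i, v α i * A (Pi.single α (Pi.single i 1), 0)) + w * A (0, 1) := by
  have hv : (v, w) =
      (∑ α, ∑ i, v α i • ((Pi.single α (Pi.single i 1), 0) : (Fin (r+1) → Fin n → ℝ) × ℝ))
        + w • (0, 1) := by
    refine Prod.ext ?_ ?_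
    · ext α i
      simp [Prod.fst_sum, Finset.sum_apply, Pi.single_apply, apply_ite]
    · simp [Prod.snd_sum]
  rw [hv]
  simp only [map_add, map_sum, map_smul, smul_eq_mul]

/-- Along a solution of the Herglotz ODE, the time derivative of a jet function `F` is
`D_L F + (∂L/∂z) F`. -/
theorem IsSmoothOfOrder.hasDerivAt_lift {n k r : ℕ} {L : (Fin (k+1) → Fin n → ℝ) → ℝ → ℝ}
    {c : ℝ → Fin n → ℝ} (hc : ContDiff ℝ (⊤ : ℕ∞) c) {z : ℝ → ℝ} (hode : HerglotzODE k L c z)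
    {F : Jet n → ℝ → ℝ} (hF : IsSmoothOfOrder r F) (t : ℝ) :
    HasDerivAt (fun s => F (lift c s) (z s))
      (HOC.DL (ext k L) r F (lift c t) (z t)
        + F (lift c t) (z t) * HOC.pz (ext k L) (lift c t) (z t)) t := by
  obtain ⟨G, hG, rfl⟩ := hF
  have hcomp := (hG.hasFDerivAt (jetk r c t, z t)).comp_hasDerivAt t
    ((hasDerivAt_jetk_s12 hc r t).prodMk (hode t))
  refine HasDerivAt.congr_deriv hcomp ?_
  rw [map_prod_pi_eq_sum]
  simp only [HOC.DL, Finset.sum_range, pq_ext hG, pz_ext hG]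
  change _ + _ = _ + L (jetk k c t) (z t) * _ - _ + _
  rw [add_sub_assoc, add_assoc, mul_comm (ext r G _ _), sub_add_cancel]
  rfl

theorem hasDerivAt_momentum_succ {n k : ℕ} {L : (Fin (k+1) → Fin n → ℝ) → ℝ → ℝ} (hL : SmoothL L)
    {c : ℝ → Fin n → ℝ} (hc : ContDiff ℝ (⊤ : ℕ∞) c) {z : ℝ → ℝ} (hode : HerglotzODE k L c z)
    {r : ℕ} (hr : r < k) (t : ℝ) (i : Fin n) :
    HasDerivAt (fun s => momentum k L (r+1) i (lift c s) (z s))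
      (-(momentum k L r i (lift c t) (z t))
        + pq (ext k L) r i (lift c t) (z t)
        + momentum k L (r+1) i (lift c t) (z t) * pz (ext k L) (lift c t) (z t)) t := by
  have hLx : IsSmoothOfOrder k (ext k L) := ⟨L, hL, rfl⟩
  have hsum := HasDerivAt.fun_sum fun α (_ : α ∈ Finset.range (k - (r+1) + 1)) =>
    ((IsSmoothOfOrder.DLpow hLx (hLx.pq (r+1+α) i) α).hasDerivAt_lift hc hode t).const_mul
      ((-1:ℝ)^α)
  refine HasDerivAt.congr_deriv hsum ?_
  have hk : k - (r+1) + 1 = k - r := by omega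
  simp only [momentum, hk]
  rw [Finset.sum_range_succ' _ (k - r), Finset.sum_mul]
  simp only [mul_add, Finset.sum_add_distrib, pow_succ, DLpow, ← mul_assoc, add_zero, pow_zero,
    one_mul, mul_neg, mul_one, neg_mul, Finset.sum_neg_distrib]
  have hidx : ∀ α : ℕ, r + 1 + α = r + (α + 1) := fun α => by omega
  simp only [hidx]
  ring

/-- Evolution of the Jacobi–Ostrogradskii momenta along Herglotz
solutions (Hamilton equations on the Legendre image). -/
theorem momenta_evolution_along_herglotz_solutions
    {n k : ℕ} (L : (Fin (k+1) → Fin n → ℝ) → ℝ → ℝ) (hL : SmoothL L)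
    (c : ℝ → Fin n → ℝ) (hc : ContDiff ℝ (⊤ : ℕ∞) c)
    (z : ℝ → ℝ) (hz : ContDiff ℝ (⊤ : ℕ∞) z)
    (hode : HerglotzODE k L c z) (heqs : HerglotzEqs k L c z) :
    (∀ (t : ℝ) (i : Fin n),
      HasDerivAt (fun s => momentum k L 1 i (lift c s) (z s))
        (pq (ext k L) 0 i (lift c t) (z t)
          + momentum k L 1 i (lift c t) (z t) * pz (ext k L) (lift c t) (z t)) t) ∧
    (∀ r : ℕ, 1 ≤ r → r ≤ k - 1 → ∀ (t : ℝ) (i : Fin n),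
      HasDerivAt (fun s => momentum k L (r+1) i (lift c s) (z s))
        (-(momentum k L r i (lift c t) (z t))
          + pq (ext k L) r i (lift c t) (z t)
          + momentum k L (r+1) i (lift c t) (z t) * pz (ext k L) (lift c t) (z t)) t) := by
  refine ⟨fun t i => ?_, fun r _ hr t i => ?_⟩
  · have h0 : momentum k L 0 i (lift c t) (z t) = 0 := by
      simpa [momentum] using heqs t i
    rcases Nat.eq_zero_or_pos k with rfl | hk
    · have h1 : momentum 0 L 1 i = fun _ _ => 0 := by
        ext q w
        simp [momentum, DLpow, pq_ext_of_lt]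
      have h2 : pq (ext 0 L) 0 i (lift c t) (z t) = 0 := by
        simpa [momentum, DLpow] using h0
      simpa [h1, h2] using hasDerivAt_const t (0 : ℝ)
    · simpa [h0] using hasDerivAt_momentum_succ hL hc hode hk t i
  · exact hasDerivAt_momentum_succ hL hc hode (by omega) t i

end HOC
end
end

section
/- Equations of motion of the damped Pais–Uhlenbeck oscillator: Let n = 1, k = 2, and L(q₀,q₁,q₂,z) = ½(q₁² − ω²q₀² − λq₂²) − γz, where λ ≠ 0, ω ∈ ℝ, γ ≥ 0. Then a smooth pair (q, z) : ℝ → ℝ × ℝ satisfies the 2k-th order Herglotz system for L (i.e. z′(t) = L(q(t), q′(t), q″(t), z(t)) and the Herglotz equations hold) if and only if for all t: q⁗(t) = −(1/λ)(ω² q(t) + γ q′(t) + (1 + λγ²) q″(t) + 2γλ q‴(t)) and z′(t) = ½(q′(t)² − ω²q(t)² − λq″(t)²) − γz(t). -/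
open scoped BigOperators

noncomputable section

namespace HOC

theorem iteratedDeriv_fun_const {ι : Type*} [Fintype ι] {f : ℝ → ℝ}
    (hf : ContDiff ℝ (⊤ : ℕ∞) f) (m : ℕ) :
    iteratedDeriv m (fun t (_ : ι) => f t) = fun t _ => iteratedDeriv m f t := by
  induction m with
  | zero => simp
  | succ m ih =>
    have hd : Differentiable ℝ (iteratedDeriv m f) :=
      hf.differentiable_iteratedDeriv m (mod_cast WithTop.coe_lt_top (m : ℕ))
    funext t
    rw [iteratedDeriv_succ, ih, deriv_pi fun _ => hd t, iteratedDeriv_succ]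

theorem pq_linear (m : ℕ) (a : ℕ → ℝ) (α : ℕ) (hα : α ∈ Finset.range m) (i : Fin 1)
    (q : Jet 1) (z : ℝ) :
    pq (fun (q : Jet 1) _ => ∑ β ∈ Finset.range m, a β * q β 0) α i q z = a α := by
  obtain rfl : i = 0 := Subsingleton.elim _ _
  have h (s : ℝ) : ∑ β ∈ Finset.range m,
      a β * (Function.update q α (Function.update (q α) 0 s)) β 0
        = a α * s + ∑ β ∈ (Finset.range m).erase α, a β * q β 0 := by
    rw [← Finset.add_sum_erase _ _ hα]
    congr 1
    · simp
    · refine Finset.sum_congr rfl fun β hβ => ?_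
      rw [Function.update_of_ne (Finset.ne_of_mem_erase hβ)]
  simp [pq, h]

/-- If `∂L/∂z` is the constant `-γ`, then `D_L` acts on functions that are linear in the jet
coordinates as the total derivative plus multiplication by `γ`. -/
theorem DL_linear {Lx : Jet 1 → ℝ → ℝ} {γ : ℝ} (hLx : ∀ q z, pz Lx q z = -γ) (r : ℕ)
    (a : ℕ → ℝ) :
    DL Lx r (fun (q : Jet 1) _ => ∑ β ∈ Finset.range (r + 1), a β * q β 0)
      = fun q _ => ∑ β ∈ Finset.range (r + 1), a β * (q (β + 1) 0 + γ * q β 0) := by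
  funext q z
  have h : ∑ α ∈ Finset.range (r + 1), ∑ i : Fin 1, q (α + 1) i *
      pq (fun (q : Jet 1) _ => ∑ β ∈ Finset.range (r + 1), a β * q β 0) α i q z
        = ∑ α ∈ Finset.range (r + 1), a α * q (α + 1) 0 := by
    refine Finset.sum_congr rfl fun α hα => ?_
    simp [pq_linear _ a α hα, mul_comm]
  have hz : pz (fun (q : Jet 1) _ => ∑ β ∈ Finset.range (r + 1), a β * q β 0) q z = 0 := by
    simp [pz]
  simp only [DL, h, hz, hLx, mul_add, Finset.sum_add_distrib, mul_left_comm _ γ, ← Finset.mul_sum]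
  ring

/-- Equations of motion of the damped Pais–Uhlenbeck oscillator. -/
theorem damped_pais_uhlenbeck
    (om ga lam : ℝ) (hlam : lam ≠ 0) (hga : 0 ≤ ga)
    (L : (Fin 3 → Fin 1 → ℝ) → ℝ → ℝ)
    (hLdef : ∀ (Q : Fin 3 → Fin 1 → ℝ) (w : ℝ),
      L Q w = (1/2) * ((Q 1 0)^2 - om^2 * (Q 0 0)^2 - lam * (Q 2 0)^2) - ga * w)
    (q z : ℝ → ℝ) (hq : ContDiff ℝ (⊤ : ℕ∞) q) (hz : ContDiff ℝ (⊤ : ℕ∞) z) :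
    (HerglotzODE 2 L (fun t _ => q t) z ∧ HerglotzEqs 2 L (fun t _ => q t) z)
    ↔ (∀ t : ℝ,
        iteratedDeriv 4 q t
          = -(1/lam) * (om^2 * q t + ga * deriv q t + (1 + lam * ga^2) * iteratedDeriv 2 q t
              + 2 * ga * lam * iteratedDeriv 3 q t)
        ∧ HasDerivAt z
            ((1/2) * ((deriv q t)^2 - om^2 * (q t)^2 - lam * (iteratedDeriv 2 q t)^2)
              - ga * z t) t) := by
  have hE : ext 2 L = fun (Q : Jet 1) w =>
      (1/2) * ((Q 1 0)^2 - om^2 * (Q 0 0)^2 - lam * (Q 2 0)^2) - ga * w := by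
    funext Q w
    simp [ext, hLdef]
  have hpz : ∀ Q w, pz (ext 2 L) Q w = -ga := by
    intro Q w
    simp only [pz, hE]
    rw [deriv_const_sub]
    simp
  have h0 (Q : Jet 1) (w : ℝ) : pq (ext 2 L) 0 0 Q w = -om^2 * Q 0 0 := by
    simp only [pq, hE]
    refine HasDerivAt.deriv ?_
    have h := ((((hasDerivAt_pow 2 (Q 0 0)).const_mul (om^2)).const_sub
      ((Q 1 0)^2)).sub_const (lam * (Q 2 0)^2)).const_mul (1/2 : ℝ) |>.sub_const (ga * w)
    convert h using 1
    · simp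
    · simp; ring
  have h1 : pq (ext 2 L) 1 0 = fun Q _ => ∑ β ∈ Finset.range (2 + 1),
      (if β = 1 then 1 else 0 : ℝ) * Q β 0 := by
    funext Q w
    simp only [pq, hE]
    refine HasDerivAt.deriv ?_
    have h := (((hasDerivAt_pow 2 (Q 1 0)).sub_const (om^2 * (Q 0 0)^2)).sub_const
      (lam * (Q 2 0)^2)).const_mul (1/2 : ℝ) |>.sub_const (ga * w)
    convert h using 1
    · simp
    · simp
  have h2 : pq (ext 2 L) 2 0 = fun Q _ => ∑ β ∈ Finset.range (2 + 1),
      (if β = 2 then -lam else 0 : ℝ) * Q β 0 := by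
    funext Q w
    simp only [pq, hE]
    refine HasDerivAt.deriv ?_
    have h := (((hasDerivAt_pow 2 (Q 2 0)).const_mul lam).const_sub
      ((Q 1 0)^2 - om^2 * (Q 0 0)^2)).const_mul (1/2 : ℝ) |>.sub_const (ga * w)
    convert h using 1
    · simp
    · simp; ring
  have hD1 : DL (ext 2 L) 2 (pq (ext 2 L) 1 0) = fun Q _ => Q 2 0 + ga * Q 1 0 := by
    rw [h1, DL_linear hpz]
    simp
  have hD2 : DL (ext 2 L) 2 (pq (ext 2 L) 2 0) = fun Q _ => ∑ β ∈ Finset.range (3 + 1),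
      (if β = 2 then -lam * ga else if β = 3 then -lam else 0 : ℝ) * Q β 0 := by
    rw [h2, DL_linear hpz]
    funext Q _
    simp [Finset.sum_range_succ]
    ring
  have hDD2 : DL (ext 2 L) 3 (DL (ext 2 L) 2 (pq (ext 2 L) 2 0)) = fun Q _ =>
      -lam * (Q 4 0 + 2 * ga * Q 3 0 + ga^2 * Q 2 0) := by
    rw [hD2, DL_linear hpz]
    funext Q _
    simp [Finset.sum_range_succ]
    ring
  have hODE : HerglotzODE 2 L (fun t _ => q t) z ↔ ∀ t : ℝ, HasDerivAt z
      ((1/2) * ((deriv q t)^2 - om^2 * (q t)^2 - lam * (iteratedDeriv 2 q t)^2) - ga * z t) t := by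
    simp [HerglotzODE, hLdef, jetk, iteratedDeriv_fun_const hq, iteratedDeriv_one]
  have hEqs : HerglotzEqs 2 L (fun t _ => q t) z ↔ ∀ t : ℝ, iteratedDeriv 4 q t
      = -(1/lam) * (om^2 * q t + ga * deriv q t + (1 + lam * ga^2) * iteratedDeriv 2 q t
          + 2 * ga * lam * iteratedDeriv 3 q t) := by
    refine forall_congr' fun t => ?_
    rw [Fin.forall_fin_one]
    simp only [Finset.sum_range_succ, Finset.sum_range_zero, DLpow, add_zero, Nat.reduceAdd, h0,
      hD1, hDD2, lift, iteratedDeriv_fun_const hq, iteratedDeriv_zero, iteratedDeriv_one]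
    field_simp
    constructor <;> intro h <;> linear_combination -h
  rw [hODE, hEqs, and_comm, forall_and]

end HOC
end
end
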